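/- arXiv:1803.03788 — 3 statements merged into one kernel-verified Lean document; each statement's English description precedes it below -/
import Mathlib

section
/- Let f : [0,1] → [0,1] be a uniformly hyperbolic, piecewise monotone interval map with monotonicity partition 𝓘, and let 𝓘_n(x) denote the element of the n-th refinement ⋁_{i=0}^{n-1} f^{-i}𝓘 containing x. Let A be a compact f-invariant uncountable set such that f restricted to A is topologically transitive. For a probability measure μ with supp(μ) = A and ρ > 0, set Δ_ρ(x) = {n ≥ 1 : μ(f^n(𝓘_n(x))) > ρ} and N_ρ(A,μ) = {x ∈ A : Δ_ρ(x) is finite}. Then lim_{ρ→0+} dim_H N_ρ(A,μ) = 0. -/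
open Set Filter MeasureTheory

noncomputable section

/-- The cell of the `n`-th refinement `⋁_{j<n} f^{-j} 𝓘` of the monotonicity partition `𝓘`
containing `x`: the set of points having the same itinerary as `x` for `n` steps. -/
def refCell (M : ℕ) (f : ℝ → ℝ) (I : Fin M → Set ℝ) (n : ℕ) (x : ℝ) : Set ℝ :=
  {y | ∀ j < n, ∀ i, f^[j] x ∈ I i → f^[j] y ∈ I i}

/-- The points of `[0,1]` whose orbit meets `P` at some time before `N`. -/
def cutSet (f : ℝ → ℝ) (P : Set ℝ) (N : ℕ) : Set ℝ :=
  {x ∈ Icc (0 : ℝ) 1 | ∃ j < N, f^[j] x ∈ P}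

theorem finite_inter_preimage {M : ℕ} {I : Fin M → Set ℝ} {f : ℝ → ℝ}
    (hcover : ⋃ i, I i = Icc (0 : ℝ) 1) (hinj : ∀ i, InjOn f (I i)) {S : Set ℝ}
    (hS : S.Finite) : {x ∈ Icc (0 : ℝ) 1 | f x ∈ S}.Finite := by
  have hsub : {x ∈ Icc (0 : ℝ) 1 | f x ∈ S} ⊆ ⋃ i, (I i ∩ f ⁻¹' S) := by
    rintro x ⟨hx, hfx⟩
    rw [← hcover] at hx
    obtain ⟨i, hi⟩ := mem_iUnion.1 hx
    exact mem_iUnion.2 ⟨i, hi, hfx⟩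
  refine (finite_iUnion fun i => ?_).subset hsub
  exact Finite.of_finite_image (hS.subset (by rintro _ ⟨x, hx, rfl⟩; exact hx.2))
    ((hinj i).mono inter_subset_left)

theorem finite_cutSet {M : ℕ} {I : Fin M → Set ℝ} {f : ℝ → ℝ} {P : Set ℝ}
    (hcover : ⋃ i, I i = Icc (0 : ℝ) 1) (hinj : ∀ i, InjOn f (I i))
    (hmaps : MapsTo f (Icc (0 : ℝ) 1) (Icc (0 : ℝ) 1)) (hP : P.Finite) (N : ℕ) :
    (cutSet f P N).Finite := by
  have hlevel : ∀ j : ℕ, {x ∈ Icc (0 : ℝ) 1 | f^[j] x ∈ P}.Finite := by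
    intro j
    induction j with
    | zero => exact hP.subset fun x hx => hx.2
    | succ j ih =>
      exact (finite_inter_preimage hcover hinj ih).subset
        fun x hx => ⟨hx.1, hmaps hx.1, hx.2⟩
  refine ((finite_lt_nat N).biUnion fun j _ => hlevel j).subset ?_
  rintro x ⟨hx, j, hj, hxj⟩
  exact mem_biUnion (show j ∈ {i | i < N} from hj) ⟨hx, hxj⟩

theorem ordConnected_of_Ioo_subset_of_subset_Icc {s : Set ℝ} {p q : ℝ} (h₁ : Ioo p q ⊆ s)
    (h₂ : s ⊆ Icc p q) : s.OrdConnected := by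
  refine ⟨fun a ha b hb z hz => ?_⟩
  rcases hz.1.eq_or_lt with rfl | haz
  · exact ha
  rcases hz.2.eq_or_lt with rfl | hzb
  · exact hb
  exact h₁ ⟨(h₂ ha).1.trans_lt haz, hzb.trans_le (h₂ hb).2⟩

/-- Points of `[0,1]` not separated by a point of `cutSet f P N` have the same itinerary
up to time `N`. -/
theorem itinerary_eq_of_disjoint_cutSet {M : ℕ} {I : Fin M → Set ℝ} {f : ℝ → ℝ} {P : Set ℝ}
    {κ : ℝ → Fin M} (hκ : ∀ x ∈ Icc (0 : ℝ) 1, ∀ i, x ∈ I i ↔ κ x = i)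
    (hP : ∀ i, ∃ p ∈ P, ∃ q ∈ P, Ioo p q ⊆ I i ∧ I i ⊆ Icc p q)
    (hcont : ∀ i, ContinuousOn f (I i))
    (hmaps : MapsTo f (Icc (0 : ℝ) 1) (Icc (0 : ℝ) 1)) {N : ℕ} {x y : ℝ} (hxy : x ≤ y)
    (hx : 0 ≤ x) (hy : y ≤ 1) (hdisj : Disjoint (Icc x y) (cutSet f P N)) :
    ∀ j < N, κ (f^[j] x) = κ (f^[j] y) := by
  have hU : Icc x y ⊆ Icc 0 1 := Icc_subset_Icc hx hy
  have key : ∀ j < N, ContinuousOn f^[j] (Icc x y) →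
      MapsTo f^[j] (Icc x y) (I (κ (f^[j] x))) := by
    intro j hj hc
    have hx01 : f^[j] x ∈ Icc (0 : ℝ) 1 := hmaps.iterate j (hU (left_mem_Icc.2 hxy))
    obtain ⟨p, hp, q, hq, h₁, h₂⟩ := hP (κ (f^[j] x))
    have hconn : (f^[j] '' Icc x y).OrdConnected :=
      (isPreconnected_Icc.image _ hc).ordConnected
    have havoid : ∀ c ∈ P, c ∉ f^[j] '' Icc x y := by
      rintro _ hc ⟨u, hu, rfl⟩
      exact disjoint_left.1 hdisj hu ⟨hU hu, j, hj, hc⟩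
    have hxm : f^[j] x ∈ f^[j] '' Icc x y := mem_image_of_mem _ (left_mem_Icc.2 hxy)
    have hxI := h₂ ((hκ _ hx01 _).2 rfl)
    intro u hu
    have hum : f^[j] u ∈ f^[j] '' Icc x y := mem_image_of_mem _ hu
    refine h₁ ⟨?_, ?_⟩ <;> by_contra! hlt
    · exact havoid p hp (hconn.out hum hxm ⟨hlt, hxI.1⟩)
    · exact havoid q hq (hconn.out hxm hum ⟨hxI.2, hlt⟩)
  have hc : ∀ j ≤ N, ContinuousOn f^[j] (Icc x y) := by
    intro j
    induction j with
    | zero => exact fun _ => continuousOn_id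
    | succ j ih =>
      intro hj
      rw [Function.iterate_succ']
      exact (hcont _).comp (ih (by omega)) (key j (by omega) (ih (by omega)))
  intro j hj
  have hy01 : f^[j] y ∈ Icc (0 : ℝ) 1 := hmaps.iterate j (hU (right_mem_Icc.2 hxy))
  exact ((hκ _ hy01 _).1 (key j hj (hc j hj.le) (right_mem_Icc.2 hxy))).symm

/-- Two points off `cutSet f P N` with different itineraries up to time `N` are strictly
separated by a point of `cutSet f P N`. -/
theorem exists_mem_cutSet_of_itinerary_ne {M : ℕ} {I : Fin M → Set ℝ} {f : ℝ → ℝ} {P : Set ℝ}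
    {κ : ℝ → Fin M} (hκ : ∀ x ∈ Icc (0 : ℝ) 1, ∀ i, x ∈ I i ↔ κ x = i)
    (hP : ∀ i, ∃ p ∈ P, ∃ q ∈ P, Ioo p q ⊆ I i ∧ I i ⊆ Icc p q)
    (hcont : ∀ i, ContinuousOn f (I i))
    (hmaps : MapsTo f (Icc (0 : ℝ) 1) (Icc (0 : ℝ) 1)) {N : ℕ} {x y : ℝ} (hxy : x ≤ y)
    (hx : x ∈ Icc (0 : ℝ) 1 \ cutSet f P N) (hy : y ∈ Icc (0 : ℝ) 1 \ cutSet f P N)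
    {j : ℕ} (hj : j < N) (hne : κ (f^[j] x) ≠ κ (f^[j] y)) :
    ∃ e ∈ cutSet f P N, x < e ∧ e < y := by
  have hnd : ¬ Disjoint (Icc x y) (cutSet f P N) := fun hd =>
    hne (itinerary_eq_of_disjoint_cutSet hκ hP hcont hmaps hxy hx.1.1 hy.1.2 hd j hj)
  obtain ⟨e, he, heC⟩ := not_disjoint_iff.1 hnd
  refine ⟨e, heC, lt_of_le_of_ne he.1 ?_, lt_of_le_of_ne he.2 ?_⟩
  · rintro rfl; exact hx.2 heC
  · rintro rfl; exact hy.2 heC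

/-- If `u, v` lie in a common element of the partition, `w` lies in another one, and `u, v` have
different itineraries up to time `N`, then the hull of the three points contains an interval
between two points of `cutSet f P N` which meets `{u, v}`. -/
theorem exists_Ioo_cutSet_subset {M : ℕ} {I : Fin M → Set ℝ} {f : ℝ → ℝ} {P : Set ℝ}
    {κ : ℝ → Fin M} (hκ : ∀ x ∈ Icc (0 : ℝ) 1, ∀ i, x ∈ I i ↔ κ x = i)
    (hP : ∀ i, ∃ p ∈ P, ∃ q ∈ P, Ioo p q ⊆ I i ∧ I i ⊆ Icc p q)
    (hcont : ∀ i, ContinuousOn f (I i))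
    (hmaps : MapsTo f (Icc (0 : ℝ) 1) (Icc (0 : ℝ) 1)) {N : ℕ} {u v w : ℝ}
    (hu : u ∈ Icc (0 : ℝ) 1 \ cutSet f P N) (hv : v ∈ Icc (0 : ℝ) 1 \ cutSet f P N)
    (hw : w ∈ Icc (0 : ℝ) 1 \ cutSet f P N) (huv : κ u = κ v) (huw : κ u ≠ κ w)
    {j : ℕ} (hj : j < N) (hne : κ (f^[j] u) ≠ κ (f^[j] v)) {J : Set ℝ} (hJ : J.OrdConnected)
    (huJ : u ∈ J) (hvJ : v ∈ J) (hwJ : w ∈ J) :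
    ∃ e ∈ cutSet f P N, ∃ e' ∈ cutSet f P N,
      (u ∈ Ioo e e' ∨ v ∈ Ioo e e') ∧ Ioo e e' ⊆ J := by
  wlog hle : u ≤ v generalizing u v
  · obtain ⟨e, he, e', he', h₁, h₂⟩ := this hv hu huv.symm (huv ▸ huw) hne.symm hvJ huJ
      (not_le.1 hle).le
    exact ⟨e, he, e', he', h₁.symm, h₂⟩
  have hord : (I (κ u)).OrdConnected := by
    obtain ⟨p, -, q, -, h₁, h₂⟩ := hP (κ u)
    exact ordConnected_of_Ioo_subset_of_subset_Icc h₁ h₂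
  have huI : u ∈ I (κ u) := (hκ u hu.1 _).2 rfl
  have hvI : v ∈ I (κ u) := (hκ v hv.1 _).2 huv.symm
  have hwI : w ∉ I (κ u) := fun h => huw ((hκ w hw.1 _).1 h).symm
  have hN : 0 < N := by omega
  obtain ⟨e, he, hue, hev⟩ :=
    exists_mem_cutSet_of_itinerary_ne hκ hP hcont hmaps hle hu hv hj hne
  rcases le_total w u with hwu | hwu
  · obtain ⟨q, hq, hwq, hqu⟩ := exists_mem_cutSet_of_itinerary_ne hκ hP hcont hmaps hwu hw hu
      hN (j := 0) (by simpa using huw.symm)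
    exact ⟨q, hq, e, he, Or.inl ⟨hqu, hue⟩,
      fun z hz => hJ.out hwJ hvJ ⟨(hwq.trans hz.1).le, (hz.2.trans hev).le⟩⟩
  · have hvw : v ≤ w := by
      by_contra! h
      exact hwI (hord.out huI hvI ⟨hwu, h.le⟩)
    obtain ⟨q, hq, hvq, hqw⟩ := exists_mem_cutSet_of_itinerary_ne hκ hP hcont hmaps hvw hv hw
      hN (j := 0) (by simpa [← huv] using huw)
    exact ⟨e, he, q, hq, Or.inr ⟨hev, hvq⟩,
      fun z hz => hJ.out huJ hwJ ⟨(hue.trans hz.1).le, (hz.2.trans hqw).le⟩⟩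

theorem mem_refCell_iff {M : ℕ} {I : Fin M → Set ℝ} {f : ℝ → ℝ}
    {κ : ℝ → Fin M} (hκ : ∀ x ∈ Icc (0 : ℝ) 1, ∀ i, x ∈ I i ↔ κ x = i)
    (hmaps : MapsTo f (Icc (0 : ℝ) 1) (Icc (0 : ℝ) 1)) {x y : ℝ} (hx : x ∈ Icc (0 : ℝ) 1)
    (hy : y ∈ Icc (0 : ℝ) 1) (n : ℕ) :
    y ∈ refCell M f I n x ↔ ∀ j < n, κ (f^[j] x) = κ (f^[j] y) := by
  refine forall₂_congr fun j _ => ?_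
  simp only [hκ _ (hmaps.iterate j hx), hκ _ (hmaps.iterate j hy), forall_eq']
  exact eq_comm

theorem ordConnected_image_refCell {M : ℕ} {I : Fin M → Set ℝ} {f : ℝ → ℝ}
    {κ : ℝ → Fin M} (hκ : ∀ x ∈ Icc (0 : ℝ) 1, ∀ i, x ∈ I i ↔ κ x = i)
    (hord : ∀ i, (I i).OrdConnected) (hcont : ∀ i, ContinuousOn f (I i))
    (hmaps : MapsTo f (Icc (0 : ℝ) 1) (Icc (0 : ℝ) 1)) {x : ℝ} (hx : x ∈ Icc (0 : ℝ) 1)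
    (n : ℕ) : (f^[n] '' refCell M f I n x).OrdConnected := by
  induction n with
  | zero =>
    have : f^[0] '' refCell M f I 0 x = univ := by simp [refCell]
    rw [this]
    exact ordConnected_univ
  | succ n ih =>
    have himage : f^[n + 1] '' refCell M f I (n + 1) x =
        f '' (f^[n] '' refCell M f I n x ∩ I (κ (f^[n] x))) := by
      have hcell : refCell M f I (n + 1) x =
          refCell M f I n x ∩ f^[n] ⁻¹' I (κ (f^[n] x)) := by
        ext y
        have hxn := hκ _ (hmaps.iterate n hx)
        simp only [refCell, Nat.lt_succ_iff_lt_or_eq, or_imp, forall_and, forall_eq, mem_ofPred_eq,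
          mem_inter_iff, mem_preimage, hxn, forall_eq']
      rw [hcell, Function.iterate_succ', image_comp, image_inter_preimage]
    rw [himage]
    exact ((ih.inter (hord _)).isPreconnected.image _
      ((hcont _).mono inter_subset_right)).ordConnected

theorem pow_mul_abs_sub_le {M : ℕ} {I : Fin M → Set ℝ} {f : ℝ → ℝ}
    {κ : ℝ → Fin M} (hκ : ∀ x ∈ Icc (0 : ℝ) 1, ∀ i, x ∈ I i ↔ κ x = i)
    (hmaps : MapsTo f (Icc (0 : ℝ) 1) (Icc (0 : ℝ) 1)) {lam : ℝ} (hlam : 0 ≤ lam)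
    (hexp : ∀ i, ∀ x ∈ I i, ∀ y ∈ I i, lam * |x - y| ≤ |f x - f y|) {x y : ℝ}
    (hx : x ∈ Icc (0 : ℝ) 1) (hy : y ∈ Icc (0 : ℝ) 1) (n : ℕ)
    (h : ∀ j < n, κ (f^[j] x) = κ (f^[j] y)) :
    lam ^ n * |x - y| ≤ |f^[n] x - f^[n] y| := by
  induction n with
  | zero => simp
  | succ n ih =>
    calc lam ^ (n + 1) * |x - y| = lam * (lam ^ n * |x - y|) := by ring
      _ ≤ lam * |f^[n] x - f^[n] y| := by
        gcongr
        exact ih fun j hj => h j (by omega)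
      _ ≤ |f^[n + 1] x - f^[n + 1] y| := by
        simp only [Function.iterate_succ_apply']
        exact hexp (κ (f^[n] x)) _ ((hκ _ (hmaps.iterate n hx) _).2 rfl) _
          ((hκ _ (hmaps.iterate n hy) _).2 (h n (by omega)).symm)

/-- If after each splitting time `n ≥ m` of the itineraries of points of `X` no further splitting
occurs before time `n + N`, then the itineraries up to time `m + k * N` are determined by
`m + k` symbols. -/
theorem exists_itinerary_coding {α : Type*} {M : ℕ} {f : α → α} {κ : α → Fin M} {X : Set α}
    {m N : ℕ}
    (h : ∀ n ≥ m, ∀ x ∈ X, ∀ y ∈ X, ∀ z ∈ X, (∀ j < n, κ (f^[j] x) = κ (f^[j] y)) →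
      (∀ j < n, κ (f^[j] x) = κ (f^[j] z)) → κ (f^[n] x) = κ (f^[n] y) →
      κ (f^[n] x) ≠ κ (f^[n] z) → ∀ j < N, κ (f^[j] (f^[n] x)) = κ (f^[j] (f^[n] y))) (k : ℕ) :
    ∃ g : α → (Fin (m + k) → Fin M), ∀ x ∈ X, ∀ y ∈ X, g x = g y →
      ∀ j < m + k * N, κ (f^[j] x) = κ (f^[j] y) := by
  classical
  induction k with
  | zero =>
    refine ⟨fun x i => κ (f^[i] x), fun x _ y _ hg j hj => ?_⟩
    exact congrFun hg ⟨j, by simpa using hj⟩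
  | succ k ih =>
    obtain ⟨g, hg⟩ := ih
    set n := m + k * N with hn
    let S : (Fin (m + k) → Fin M) → ℕ → Prop := fun t i =>
      n ≤ i ∧ ∃ x ∈ X, ∃ y ∈ X, g x = t ∧ g y = t ∧ κ (f^[i] x) ≠ κ (f^[i] y)
    let τ : (Fin (m + k) → Fin M) → ℕ := fun t => if ht : ∃ i, S t i then Nat.find ht else 0
    refine ⟨fun x => Fin.cons (κ (f^[τ (g x)] x)) (g x), fun x hx y hy hxy => ?_⟩
    obtain ⟨hτ, hgxy⟩ := Fin.cons_inj.1 hxy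
    rw [← hgxy] at hτ
    have hagree : ∀ i, ¬ S (g x) i → ∀ y ∈ X, g x = g y → κ (f^[i] x) = κ (f^[i] y) := by
      intro i hi y hy hxy
      rcases lt_or_ge i n with hin | hin
      · exact hg x hx y hy hxy i hin
      · by_contra hne
        exact hi ⟨hin, x, hx, y, hy, rfl, hxy.symm, hne⟩
    intro j hj
    by_cases ht : ∃ i, S (g x) i
    · have hτt : τ (g x) = Nat.find ht := dif_pos ht
      rw [hτt] at hτ
      obtain ⟨hle, a, ha, b, hb, hga, hgb, hab⟩ := Nat.find_spec ht
      obtain ⟨z, hz, hgz, hxz⟩ : ∃ z ∈ X, g x = g z ∧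
          κ (f^[Nat.find ht] x) ≠ κ (f^[Nat.find ht] z) := by
        by_contra! hcon
        exact hab ((hcon a ha hga.symm).symm.trans (hcon b hb hgb.symm))
      have hbefore : ∀ w ∈ X, g x = g w → ∀ j < Nat.find ht, κ (f^[j] x) = κ (f^[j] w) :=
        fun w hw hxw j hj => hagree j (Nat.find_min ht hj) w hw hxw
      rcases lt_or_ge j (Nat.find ht) with hjt | hjt
      · exact hbefore y hy hgxy j hjt
      · obtain ⟨i, rfl⟩ := Nat.exists_eq_add_of_le' hjt
        have hi : i < N := by
          rw [add_mul, one_mul] at hj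
          omega
        simpa only [Function.iterate_add_apply] using h _ (by omega) x hx y hy z hz
          (hbefore y hy hgxy) (hbefore z hz hgz) hτ hxz i hi
    · exact hagree j (fun hS => ht ⟨j, hS⟩) y hy hgxy

theorem NNReal.pow_rpow_comm (x : NNReal) (n : ℕ) (s : ℝ) : (x ^ n) ^ s = (x ^ s) ^ n := by
  rw [← NNReal.rpow_natCast, ← NNReal.rpow_natCast, ← NNReal.rpow_mul, ← NNReal.rpow_mul, mul_comm]

theorem dimH_le_of_exists_coding {X : Type*} [EMetricSpace X] {S : Set X} {M m : ℕ}
    {δ s : NNReal} (hδ : δ < 1) (hM : M * δ ^ (s : ℝ) ≤ 1)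
    (h : ∀ k, ∃ g : X → (Fin (m + k) → Fin M), ∀ x ∈ S, ∀ y ∈ S, g x = g y →
      edist x y ≤ (δ : ENNReal) ^ k) : dimH S ≤ s := by
  borelize X
  choose g hg using h
  refine dimH_le_of_hausdorffMeasure_ne_top (ne_top_of_le_ne_top
    (ENNReal.natCast_ne_top (M ^ m)) ?_)
  have hdiam : ∀ k t, Metric.ediam (S ∩ g k ⁻¹' {t}) ≤ (δ : ENNReal) ^ k := fun k t =>
    Metric.ediam_le fun x hx y hy => hg k x hx.1 y hy.1 (hx.2.trans hy.2.symm)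
  refine (Measure.hausdorffMeasure_le_liminf_sum (l := atTop) (s : ℝ) S
    (fun k : ℕ => (δ : ENNReal) ^ k)
    (ENNReal.tendsto_pow_atTop_nhds_zero_of_lt_one (by exact_mod_cast hδ))
    (fun k t => S ∩ g k ⁻¹' {t}) (Eventually.of_forall hdiam)
    (Eventually.of_forall fun k x hx => mem_iUnion.2 ⟨g k x, hx, rfl⟩)).trans ?_
  refine liminf_le_of_le (by isBoundedDefault) fun b hb => ?_
  obtain ⟨k, hk⟩ := hb.exists
  refine hk.trans ?_
  calc ∑ t, Metric.ediam (S ∩ g k ⁻¹' {t}) ^ (s : ℝ)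
      ≤ ∑ _t : Fin (m + k) → Fin M, ((δ : ENNReal) ^ k) ^ (s : ℝ) := by
        gcongr with t
        exact hdiam k t
    _ = ((M ^ m * (M * δ ^ (s : ℝ)) ^ k : NNReal) : ENNReal) := by
        rw [Finset.sum_const, Finset.card_univ, Fintype.card_fun, Fintype.card_fin,
          Fintype.card_fin, nsmul_eq_mul, ← ENNReal.coe_pow,
          ← ENNReal.coe_rpow_of_nonneg _ s.coe_nonneg, NNReal.pow_rpow_comm]
        push_cast
        ring
    _ ≤ ((M ^ m * 1 ^ k : NNReal) : ENNReal) := by gcongr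
    _ = ((M ^ m : ℕ) : ENNReal) := by simp

theorem eventually_lt_measure_Ioo {μ : Measure ℝ} {A C : Set ℝ} (hC : C.Finite)
    (hsupp : ∀ U : Set ℝ, IsOpen U → (U ∩ A).Nonempty → μ U ≠ 0) :
    ∀ᶠ ρ : ℝ in nhdsWithin 0 (Ioi 0), ∀ e ∈ C, ∀ e' ∈ C, (Ioo e e' ∩ A).Nonempty →
      ENNReal.ofReal ρ < μ (Ioo e e') := by
  refine (eventually_all_finite hC).2 fun e _ => (eventually_all_finite hC).2 fun e' _ => ?_
  by_cases hne : (Ioo e e' ∩ A).Nonempty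
  · have hlim : Tendsto ENNReal.ofReal (nhdsWithin 0 (Ioi 0)) (nhds 0) := by
      simpa using (ENNReal.continuous_ofReal.tendsto 0).mono_left nhdsWithin_le_nhds
    filter_upwards [hlim.eventually_lt_const (hsupp _ isOpen_Ioo hne).bot_lt] with ρ hρ _
    exact hρ
  · exact Eventually.of_forall fun _ h => absurd h hne

theorem exists_nat_mul_pow_rpow_le_one {r : NNReal} (hr : r < 1) {s : NNReal} (hs : 0 < s)
    (M : ℕ) : ∃ N, 0 < N ∧ M * (r ^ N) ^ (s : ℝ) ≤ 1 := by
  have hlt : r ^ (s : ℝ) < 1 := NNReal.rpow_lt_one hr (by exact_mod_cast hs)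
  have hlim : Tendsto (fun N : ℕ => (M : NNReal) * (r ^ (s : ℝ)) ^ N) atTop (nhds 0) := by
    simpa using (tendsto_pow_atTop_nhds_zero_of_lt_one zero_le hlt).const_mul (M : NNReal)
  obtain ⟨N, hN, hpos⟩ := ((hlim.eventually_le_const one_pos).and (eventually_gt_atTop 0)).exists
  refine ⟨N, hpos, ?_⟩
  rwa [NNReal.pow_rpow_comm]

/-- **Proposition.** Let `f : [0,1] → [0,1]` be a uniformly hyperbolic, piecewise monotone
interval map with monotonicity partition `𝓘`, and let `A` be a compact `f`-invariant
uncountable set on which `f` is topologically transitive.  For a probability measure `μ`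
with `supp μ = A` let `N_ρ(A,μ)` be the set of `x ∈ A` for which
`Δ_ρ(x) = {n ≥ 1 : μ(fⁿ(𝓘_n(x))) > ρ}` is finite.  Then `dim_H N_ρ(A,μ) → 0` as `ρ → 0+`. -/
theorem stmt6 (M : ℕ) (hM : 0 < M) (I : Fin M → Set ℝ)
    -- `I` is the monotonicity partition of `[0,1]`:
    (hdisj : ∀ i j, i ≠ j → I i ∩ I j = ∅)
    (hcover : ⋃ i, I i = Icc (0 : ℝ) 1)
    (hproper : ∀ i, ∃ p q : ℝ, p < q ∧ Ioo p q ⊆ I i ∧ I i ⊆ Icc p q)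
    (f : ℝ → ℝ)
    (hmaps : MapsTo f (Icc (0 : ℝ) 1) (Icc (0 : ℝ) 1))
    -- piecewise monotone:
    (hmono : ∀ i, StrictMonoOn f (I i) ∨ StrictAntiOn f (I i))
    (hcont : ∀ i, ContinuousOn f (I i))
    -- uniformly hyperbolic:
    (lam : ℝ) (hlam : 1 < lam)
    (hexp : ∀ i, ∀ x ∈ I i, ∀ y ∈ I i, lam * |x - y| ≤ |f x - f y|)
    -- `A` compact, invariant, uncountable, topologically transitive:
    (A : Set ℝ) (hA : IsCompact A) (hAsub : A ⊆ Icc (0 : ℝ) 1)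
    (hAinv : f '' A ⊆ A) (hAunc : ¬ A.Countable)
    (htrans : ∀ U V : Set ℝ, IsOpen U → IsOpen V → (U ∩ A).Nonempty → (V ∩ A).Nonempty →
      ∃ n : ℕ, (f^[n] '' (U ∩ A) ∩ V).Nonempty)
    -- `μ` a probability measure with support `A`:
    (μ : Measure ℝ) (hprob : IsProbabilityMeasure μ)
    (hsupp₁ : μ Aᶜ = 0)
    (hsupp₂ : ∀ U : Set ℝ, IsOpen U → (U ∩ A).Nonempty → μ U ≠ 0) :
    Filter.Tendsto
      (fun ρ : ℝ => dimH {x ∈ A |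
        {n : ℕ | 1 ≤ n ∧ ENNReal.ofReal ρ < μ (f^[n] '' refCell M f I n x)}.Finite})
      (nhdsWithin 0 (Ioi 0)) (nhds 0) := by
  have hinj : ∀ i, InjOn f (I i) := fun i => (hmono i).elim StrictMonoOn.injOn StrictAntiOn.injOn
  have hκex : ∀ x, ∃ k, x ∈ Icc (0 : ℝ) 1 → x ∈ I k := by
    intro x
    by_cases hx : x ∈ Icc (0 : ℝ) 1
    · rw [← hcover] at hx
      obtain ⟨k, hk⟩ := mem_iUnion.1 hx
      exact ⟨k, fun _ => hk⟩
    · exact ⟨⟨0, hM⟩, fun h => absurd h hx⟩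
  choose κ hκmem using hκex
  have hκ : ∀ x ∈ Icc (0 : ℝ) 1, ∀ i, x ∈ I i ↔ κ x = i := by
    refine fun x hx i => ⟨fun hi => ?_, fun hi => hi ▸ hκmem x hx⟩
    by_contra hne
    have hmem : x ∈ I (κ x) ∩ I i := ⟨hκmem x hx, hi⟩
    simp [hdisj _ _ hne] at hmem
  choose p q _ hIoo hIcc using hproper
  set P : Set ℝ := range p ∪ range q
  have hPfin : P.Finite := (finite_range p).union (finite_range q)
  have hP : ∀ i, ∃ a ∈ P, ∃ b ∈ P, Ioo a b ⊆ I i ∧ I i ⊆ Icc a b := fun i =>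
    ⟨p i, Or.inl ⟨i, rfl⟩, q i, Or.inr ⟨i, rfl⟩, hIoo i, hIcc i⟩
  have hord : ∀ i, (I i).OrdConnected := fun i =>
    ordConnected_of_Ioo_subset_of_subset_Icc (hIoo i) (hIcc i)
  have hfinC := finite_cutSet hcover hinj hmaps hPfin
  set E : Set ℝ := ⋃ n, cutSet f P n
  have hEcount : E.Countable := countable_iUnion fun n => (hfinC n).countable
  have hEinv : ∀ n, ∀ x ∈ Icc (0 : ℝ) 1, x ∉ E → f^[n] x ∉ E := by
    intro n x hx hxE hn
    obtain ⟨N, -, j, hj, hjP⟩ := mem_iUnion.1 hn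
    refine hxE (mem_iUnion.2 ⟨j + n + 1, hx, j + n, by omega, ?_⟩)
    rwa [Function.iterate_add_apply]
  have hAmaps : MapsTo f A A := mapsTo_iff_image_subset.2 hAinv
  rw [ENNReal.tendsto_nhds_zero]
  intro ε hε
  obtain ⟨s, hs0, hsε⟩ := ENNReal.lt_iff_exists_nnreal_btwn.1 hε
  have hs : 0 < s := by exact_mod_cast hs0
  set r : NNReal := (Real.toNNReal lam)⁻¹ with hr
  have hlam0 : 0 < lam := one_pos.trans hlam
  have hr1 : r < 1 := inv_lt_one_of_one_lt₀ (Real.one_lt_toNNReal.2 hlam)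
  obtain ⟨N, hN, hMN⟩ := exists_nat_mul_pow_rpow_le_one hr1 hs M
  filter_upwards [eventually_lt_measure_Ioo (hfinC N) hsupp₂] with ρ hρ
  refine le_trans ?_ hsε.le
  set X : ℕ → Set ℝ := fun m => {x ∈ A \ E | ∀ n ≥ m + 1,
    ¬ ENNReal.ofReal ρ < μ (f^[n] '' refCell M f I n x)}
  have hsub : {x ∈ A | {n : ℕ | 1 ≤ n ∧
      ENNReal.ofReal ρ < μ (f^[n] '' refCell M f I n x)}.Finite} ⊆ E ∪ ⋃ m, X m := by
    rintro x ⟨hxA, hfin⟩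
    by_cases hxE : x ∈ E
    · exact Or.inl hxE
    · obtain ⟨m, hm⟩ := hfin.bddAbove
      refine Or.inr (mem_iUnion.2 ⟨m, ⟨hxA, hxE⟩, fun n hn hlt => ?_⟩)
      have := hm (show n ∈ {n : ℕ | 1 ≤ n ∧ _} from ⟨by omega, hlt⟩)
      omega
  refine (dimH_mono hsub).trans ?_
  rw [dimH_union, dimH_countable hEcount, dimH_iUnion]
  refine max_le zero_le (iSup_le fun m => ?_)
  refine dimH_le_of_exists_coding (m := m + 1) (δ := r ^ N)
    (pow_lt_one₀ zero_le hr1 hN.ne') hMN fun k => ?_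
  have hX01 : ∀ x ∈ X m, x ∈ Icc (0 : ℝ) 1 := fun x hx => hAsub hx.1.1
  have hiter : ∀ n, ∀ x ∈ X m, f^[n] x ∈ Icc (0 : ℝ) 1 \ cutSet f P N := fun n x hx =>
    ⟨hmaps.iterate n (hX01 x hx), fun hc =>
      hEinv n x (hX01 x hx) hx.1.2 (mem_iUnion.2 ⟨N, hc⟩)⟩
  obtain ⟨g, hg⟩ := exists_itinerary_coding (f := f) (κ := κ) (X := X m) (m := m + 1) (N := N)
    (by
      intro n hn x hx y hy z hz hxy hxz hy' hz' j hj
      by_contra hne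
      have hcell := fun w (hw : w ∈ X m) =>
        mem_refCell_iff (I := I) hκ hmaps (hX01 x hx) (hX01 w hw) n
      obtain ⟨e, he, e', he', hmem, hsubJ⟩ := exists_Ioo_cutSet_subset hκ hP hcont hmaps
        (hiter n x hx) (hiter n y hy) (hiter n z hz) hy' hz' hj hne
        (ordConnected_image_refCell hκ hord hcont hmaps (hX01 x hx) n)
        (mem_image_of_mem _ ((hcell x hx).2 fun _ _ => rfl))
        (mem_image_of_mem _ ((hcell y hy).2 hxy)) (mem_image_of_mem _ ((hcell z hz).2 hxz))
      have hmeet : (Ioo e e' ∩ A).Nonempty := hmem.elim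
        (fun h => ⟨_, h, hAmaps.iterate n hx.1.1⟩) (fun h => ⟨_, h, hAmaps.iterate n hy.1.1⟩)
      exact hx.2 n hn ((hρ e he e' he' hmeet).trans_le (measure_mono hsubJ))) k
  refine ⟨g, fun x hx y hy hxy => ?_⟩
  have hexpand := pow_mul_abs_sub_le hκ hmaps hlam0.le hexp (hX01 x hx) (hX01 y hy) (N * k)
    fun j hj => hg x hx y hy hxy j (by rw [mul_comm k N]; omega)
  have hle1 : lam ^ (N * k) * |x - y| ≤ 1 := by
    refine hexpand.trans ?_
    have h₁ := (hiter (N * k) x hx).1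
    have h₂ := (hiter (N * k) y hy).1
    rw [abs_le]
    constructor <;> linarith [h₁.1, h₁.2, h₂.1, h₂.2]
  have hnn : nndist x y ≤ (r ^ N) ^ k := by
    rw [← NNReal.coe_le_coe, coe_nndist, Real.dist_eq, ← pow_mul, hr, inv_pow, NNReal.coe_inv,
      NNReal.coe_pow, Real.coe_toNNReal _ hlam0.le, ← one_div, le_div_iff₀ (by positivity),
      mul_comm]
    exact hle1
  rw [edist_nndist]
  exact_mod_cast hnn
end
end

section
/- Let Q be an M × M transition matrix with entries in {0,1} and let 𝓟_erg(Q) denote the σ-invariant ergodic probability measures on the associated subshift of finite type Σ_Q. Then the set 𝓑_Q of q-step Bernoulli measures (over all recurrent symbols j and all q ≥ 1) is dense in 𝓟_erg(Q) in the entropy plus weak* topology; in particular, the convex hull of 𝓑_Q is dense in the set 𝓟_inv(Q) of all σ-invariant probability measures in the entropy plus weak* topology. -/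
open Set Filter MeasureTheory
open scoped ENNReal

noncomputable section

/-- The left shift on the full shift space `{1,…,M}^ℕ`. -/
def shiftMap (M : ℕ) : (ℕ → Fin M) → (ℕ → Fin M) := fun ω n => ω (n + 1)

/-- The subshift of finite type determined by the 0–1 transition matrix `Q`. -/
def SigmaQ (M : ℕ) (Q : Fin M → Fin M → Bool) : Set (ℕ → Fin M) :=
  {ω | ∀ n : ℕ, Q (ω n) (ω (n + 1)) = true}

/-- The cylinder set of a finite word. -/
def cylW (M : ℕ) {n : ℕ} (w : Fin n → Fin M) : Set (ℕ → Fin M) :=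
  {ω | ∀ j : Fin n, ω (j : ℕ) = w j}

/-- Kolmogorov–Sinai entropy of a shift-invariant measure, computed through cylinders. -/
def entS (M : ℕ) (μ : Measure (ℕ → Fin M)) : ℝ :=
  Filter.atTop.liminf fun n : ℕ =>
    (n : ℝ)⁻¹ * ∑ w : Fin n → Fin M, Real.negMulLog (μ (cylW M w)).toReal

/-- A symbol `j` is recurrent: some admissible loop returns to `j`. -/
def RecurrentSym (M : ℕ) (Q : Fin M → Fin M → Bool) (j : Fin M) : Prop :=
  ∃ n : ℕ, 1 ≤ n ∧ ∃ w : Fin (n + 1) → Fin M, w 0 = j ∧ w (Fin.last n) = j ∧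
    ∀ l : Fin n, Q (w l.castSucc) (w l.succ) = true

/-- An admissible loop of length `q` at the symbol `j`. -/
def IsLoop (M : ℕ) (Q : Fin M → Fin M → Bool) (q : ℕ) (j : Fin M)
    (w : Fin (q + 1) → Fin M) : Prop :=
  w 0 = j ∧ w (Fin.last q) = j ∧ ∀ l : Fin q, Q (w l.castSucc) (w l.succ) = true

/-- The cylinder of the concatenation of the loops `L 0, L 1, …, L (m-1)` (consecutive
loops overlap in the symbol `j`). -/
def loopConcatCyl (M : ℕ) (q m : ℕ) (L : Fin m → (Fin (q + 1) → Fin M)) :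
    Set (ℕ → Fin M) :=
  {ω | ∀ (a : Fin m) (b : Fin (q + 1)), ω ((a : ℕ) * q + (b : ℕ)) = L a b}

/-- `μ` is a `q`-step Bernoulli measure for the recurrent symbol `j`:
`μ = (1/q) Σ_{k<q} ((φ_q)_* μ̃) ∘ σ^{-k}` for a Bernoulli measure `μ̃` on the full shift
over the alphabet `Ω_{j,Q}^{(q)}` of `q`-step loops at `j`. -/
def IsQStepBernoulli (M : ℕ) (Q : Fin M → Fin M → Bool) (μ : Measure (ℕ → Fin M))
    (j : Fin M) (q : ℕ) : Prop :=
  1 ≤ q ∧ RecurrentSym M Q j ∧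
  ∃ (p : (Fin (q + 1) → Fin M) → ℝ≥0∞) (ν : Measure (ℕ → Fin M)),
    (∀ w, ¬ IsLoop M Q q j w → p w = 0) ∧ (∑ w, p w) = 1 ∧
    IsProbabilityMeasure ν ∧
    (∀ (m : ℕ) (L : Fin m → (Fin (q + 1) → Fin M)), (∀ a, IsLoop M Q q j (L a)) →
      ν (loopConcatCyl M q m L) = ∏ a, p (L a)) ∧
    μ = (q : ℝ≥0∞)⁻¹ • ∑ k ∈ Finset.range q, Measure.map ((shiftMap M)^[k]) ν

/-- The Shannon entropy of a finite-valued random variable `X` under `μ`. -/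
def entOf {Ω α : Type*} [MeasurableSpace Ω] [Fintype α] (μ : Measure Ω) (X : Ω → α) : ℝ :=
  ∑ a, Real.negMulLog (μ.real (X ⁻¹' {a}))

/-- The entropy of the first `n` coordinates. -/
def blockEnt (M n : ℕ) (μ : Measure (ℕ → Fin M)) : ℝ :=
  entOf μ (fun ω (i : Fin n) => ω i)

lemma negMulLog_sum_le {ι : Type*} (s : Finset ι) (f : ι → ℝ) (hf : ∀ i ∈ s, 0 ≤ f i) :
    Real.negMulLog (∑ i ∈ s, f i) ≤ ∑ i ∈ s, Real.negMulLog (f i) := by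
  have h : Real.negMulLog (∑ i ∈ s, f i) = ∑ i ∈ s, -f i * Real.log (∑ i ∈ s, f i) := by
    rw [Real.negMulLog, ← Finset.sum_mul, Finset.sum_neg_distrib]
  rw [h]
  refine Finset.sum_le_sum fun i hi => ?_
  rcases (hf i hi).eq_or_lt with h0 | h0
  · simp [← h0]
  · have := Real.log_le_log h0 (Finset.single_le_sum hf hi)
    simp only [Real.negMulLog]
    nlinarith

lemma negMulLog_le_of_pos {p r : ℝ} (hp : 0 ≤ p) (hr : 0 < r) :
    Real.negMulLog p ≤ -p * Real.log r + (r - p) := by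
  rcases hp.eq_or_lt with h0 | h0
  · simp [← h0, hr.le]
  · have := Real.log_le_sub_one_of_pos (div_pos hr h0)
    rw [Real.log_div hr.ne' h0.ne'] at this
    have h2 := mul_le_mul_of_nonneg_left this hp
    have h3 : p * (r / p - 1) = r - p := by field_simp
    simp only [Real.negMulLog]
    nlinarith

lemma sum_negMulLog_le_log_card {α : Type*} [Fintype α] (p : α → ℝ) (h0 : ∀ a, 0 ≤ p a)
    (h1 : ∑ a, p a = 1) : ∑ a, Real.negMulLog (p a) ≤ Real.log (Fintype.card α) := by
  have hne : Nonempty α := by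
    by_contra h
    rw [not_nonempty_iff] at h
    simp at h1
  have hc : (0 : ℝ) < Fintype.card α := by exact_mod_cast Fintype.card_pos
  calc ∑ a, Real.negMulLog (p a)
      ≤ ∑ a, (-p a * Real.log (Fintype.card α : ℝ)⁻¹ + ((Fintype.card α : ℝ)⁻¹ - p a)) :=
        Finset.sum_le_sum fun a _ => negMulLog_le_of_pos (h0 a) (inv_pos.2 hc)
    _ = Real.log (Fintype.card α) := by
        rw [Finset.sum_add_distrib, Finset.sum_sub_distrib, ← Finset.sum_mul,
          Finset.sum_neg_distrib, h1]
        simp [hc.ne']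

lemma sum_negMulLog_prod_le {α β : Type*} [Fintype α] [Fintype β] (p : α → β → ℝ)
    (h0 : ∀ a b, 0 ≤ p a b) (h1 : ∑ a, ∑ b, p a b = 1) :
    ∑ a, ∑ b, Real.negMulLog (p a b) ≤
      ∑ a, Real.negMulLog (∑ b, p a b) + ∑ b, Real.negMulLog (∑ a, p a b) := by
  set q : α → ℝ := fun a => ∑ b, p a b with hq
  set r : β → ℝ := fun b => ∑ a, p a b with hr
  have h1' : ∑ b, r b = 1 := by rw [hr, ← h1, Finset.sum_comm]
  have key : ∀ a b, Real.negMulLog (p a b) ≤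
      -p a b * Real.log (q a) + -p a b * Real.log (r b) + (q a * r b - p a b) := by
    intro a b
    have hqn : ∀ a, 0 ≤ q a := fun a => Finset.sum_nonneg fun b _ => h0 a b
    have hrn : ∀ b, 0 ≤ r b := fun b => Finset.sum_nonneg fun a _ => h0 a b
    rcases (h0 a b).eq_or_lt with hp | hp
    · simp [← hp, mul_nonneg (hqn a) (hrn b)]
    · have hqa : 0 < q a := hp.trans_le
        (Finset.single_le_sum (f := fun b => p a b) (fun b _ => h0 a b) (Finset.mem_univ b))
      have hrb : 0 < r b := hp.trans_le
        (Finset.single_le_sum (f := fun a => p a b) (fun a _ => h0 a b) (Finset.mem_univ a))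
      have := negMulLog_le_of_pos hp.le (mul_pos hqa hrb)
      rw [Real.log_mul hqa.ne' hrb.ne'] at this
      linarith
  calc ∑ a, ∑ b, Real.negMulLog (p a b)
      ≤ ∑ a, ∑ b, (-p a b * Real.log (q a) + -p a b * Real.log (r b)
          + (q a * r b - p a b)) :=
        Finset.sum_le_sum fun a _ => Finset.sum_le_sum fun b _ => key a b
    _ = _ := by
        simp only [Finset.sum_add_distrib, Finset.sum_sub_distrib, ← Finset.mul_sum,
          ← Finset.sum_mul, h1, h1']
        rw [Finset.sum_comm (f := fun a b => -p a b * Real.log (r b))]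
        simp only [← Finset.sum_mul, Finset.sum_neg_distrib, Real.negMulLog]
        have : ∑ a, ∑ b, p a b = 1 := h1
        simp [this, hq, hr]

lemma entOf_nonneg {Ω α : Type*} [MeasurableSpace Ω] [Fintype α] (μ : Measure Ω)
    [IsProbabilityMeasure μ] (X : Ω → α) : 0 ≤ entOf μ X :=
  Finset.sum_nonneg fun _ _ => Real.negMulLog_nonneg measureReal_nonneg measureReal_le_one

lemma entOf_comp_le {Ω α β : Type*} [MeasurableSpace Ω] [Fintype α] [MeasurableSpace α]
    [MeasurableSingletonClass α] [Fintype β] (μ : Measure Ω) [IsFiniteMeasure μ]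
    {X : Ω → α} (hX : Measurable X) (g : α → β) :
    entOf μ (fun ω => g (X ω)) ≤ entOf μ X := by
  classical
  have h : ∀ b, μ.real ((fun ω => g (X ω)) ⁻¹' {b}) =
      ∑ a with g a = b, μ.real (X ⁻¹' {a}) := by
    intro b
    rw [sum_measureReal_preimage_singleton _ (fun y _ => hX (measurableSet_singleton y))]
    congr 1
    ext ω
    simp
  unfold entOf
  rw [← Finset.sum_fiberwise (s := Finset.univ) (g := g)
    (f := fun a => Real.negMulLog (μ.real (X ⁻¹' {a})))]
  refine Finset.sum_le_sum fun b _ => ?_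
  rw [h]
  exact negMulLog_sum_le _ _ fun _ _ => measureReal_nonneg

section EntOf

variable {Ω α β : Type*} [MeasurableSpace Ω] [Fintype α] [MeasurableSpace α]
  [MeasurableSingletonClass α] [Fintype β] [MeasurableSpace β] [MeasurableSingletonClass β]

lemma sum_real_preimage_inter (μ : Measure Ω) [IsFiniteMeasure μ] {X : Ω → α} (hX : Measurable X)
    (S : Set Ω) : ∑ a, μ.real (S ∩ X ⁻¹' {a}) = μ.real S := by
  have := sum_measureReal_preimage_singleton (μ := μ.restrict S) (f := X) Finset.univ
    (fun y _ => hX (measurableSet_singleton y))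
  simp only [Finset.coe_univ, Set.preimage_univ, measureReal_restrict_apply MeasurableSet.univ,
    Set.univ_inter] at this
  rw [← this]
  refine Finset.sum_congr rfl fun a _ => ?_
  rw [measureReal_restrict_apply (hX (measurableSet_singleton a)), Set.inter_comm]

lemma sum_real_preimage (μ : Measure Ω) [IsProbabilityMeasure μ] {X : Ω → α} (hX : Measurable X) :
    ∑ a, μ.real (X ⁻¹' {a}) = 1 := by
  have := sum_real_preimage_inter μ hX univ
  simpa using this

lemma entOf_le_log_card (μ : Measure Ω) [IsProbabilityMeasure μ] {X : Ω → α}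
    (hX : Measurable X) : entOf μ X ≤ Real.log (Fintype.card α) :=
  sum_negMulLog_le_log_card _ (fun _ => measureReal_nonneg) (sum_real_preimage μ hX)

lemma entOf_prod_le (μ : Measure Ω) [IsProbabilityMeasure μ] {X : Ω → α} {Y : Ω → β}
    (hX : Measurable X) (hY : Measurable Y) :
    entOf μ (fun ω => (X ω, Y ω)) ≤ entOf μ X + entOf μ Y := by
  have hpre : ∀ a b, (fun ω => (X ω, Y ω)) ⁻¹' {(a, b)} = X ⁻¹' {a} ∩ Y ⁻¹' {b} := by
    intro a b; ext ω; simp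
  have := sum_negMulLog_prod_le (fun a b => μ.real (X ⁻¹' {a} ∩ Y ⁻¹' {b}))
    (fun _ _ => measureReal_nonneg)
    (by simp only [sum_real_preimage_inter μ hY, sum_real_preimage μ hX])
  simp only [sum_real_preimage_inter μ hY] at this
  simp_rw [Set.inter_comm (X ⁻¹' _), sum_real_preimage_inter μ hX] at this
  unfold entOf
  rw [Fintype.sum_prod_type]
  simp_rw [hpre, Set.inter_comm (X ⁻¹' _)]
  exact this

lemma sum_mul_entOf_le {ι : Type*} [Fintype ι] {c : ι → ℝ} (hc : ∀ i, 0 ≤ c i)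
    (hc1 : ∑ i, c i = 1) {ν : ι → Measure Ω} {ρ : Measure Ω} {X : Ω → α} (hX : Measurable X)
    (hρ : ∀ S, MeasurableSet S → ρ.real S = ∑ i, c i * (ν i).real S) :
    ∑ i, c i * entOf (ν i) X ≤ entOf ρ X := by
  unfold entOf
  simp_rw [Finset.mul_sum]
  rw [Finset.sum_comm]
  refine Finset.sum_le_sum fun a _ => ?_
  rw [hρ _ (hX (measurableSet_singleton a))]
  have := Real.concaveOn_negMulLog.le_map_sum (t := Finset.univ) (w := c)
    (p := fun i => (ν i).real (X ⁻¹' {a})) (fun i _ => hc i) hc1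
    (fun i _ => measureReal_nonneg)
  simpa using this

lemma entOf_le_sum_cond (μ : Measure Ω) [IsProbabilityMeasure μ] {X : Ω → α} {C : Ω → β}
    (hX : Measurable X) (hC : Measurable C) :
    entOf μ X ≤ ∑ c, μ.real (C ⁻¹' {c}) * entOf (ProbabilityTheory.cond μ (C ⁻¹' {c})) X
      + entOf μ C := by
  have h1 : entOf μ X ≤ ∑ c, ∑ a, Real.negMulLog (μ.real (X ⁻¹' {a} ∩ C ⁻¹' {c})) := by
    unfold entOf
    rw [Finset.sum_comm]
    refine Finset.sum_le_sum fun a _ => ?_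
    rw [← sum_real_preimage_inter μ hC]
    exact negMulLog_sum_le _ _ fun _ _ => measureReal_nonneg
  refine h1.trans (le_of_eq ?_)
  rw [entOf, ← Finset.sum_add_distrib]
  refine Finset.sum_congr rfl fun c _ => ?_
  have hCm : MeasurableSet (C ⁻¹' {c}) := hC (measurableSet_singleton c)
  by_cases h0 : μ (C ⁻¹' {c}) = 0
  · have : ∀ a, μ.real (X ⁻¹' {a} ∩ C ⁻¹' {c}) = 0 := fun a => by
      rw [measureReal_def, measure_mono_null Set.inter_subset_right h0]; rfl
    simp [this, measureReal_def, h0]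
  · have := ProbabilityTheory.cond_isProbabilityMeasure h0
    have hr : μ.real (C ⁻¹' {c}) ≠ 0 := by
      simpa [measureReal_def, ENNReal.toReal_eq_zero_iff] using h0
    have h2 : ∀ a, μ.real (X ⁻¹' {a} ∩ C ⁻¹' {c}) =
        μ.real (C ⁻¹' {c}) * (ProbabilityTheory.cond μ (C ⁻¹' {c})).real (X ⁻¹' {a}) := by
      intro a
      rw [measureReal_def, measureReal_def, measureReal_def, ProbabilityTheory.cond_apply hCm,
        ENNReal.toReal_mul, ENNReal.toReal_inv, Set.inter_comm]
      rw [measureReal_def] at hr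
      field_simp
    simp_rw [h2, Real.negMulLog_mul, Finset.sum_add_distrib, ← Finset.sum_mul, ← Finset.mul_sum,
      sum_real_preimage _ hX, entOf]
    ring

end EntOf

lemma shiftMap_iterate_apply (M k n : ℕ) (ω : ℕ → Fin M) :
    (shiftMap M)^[k] ω n = ω (n + k) := by
  induction k generalizing ω with
  | zero => rfl
  | succ k ih => rw [Function.iterate_succ_apply, ih, shiftMap]; congr 1

lemma measurable_shiftMap (M : ℕ) : Measurable (shiftMap M) :=
  measurable_pi_lambda _ fun n => measurable_pi_apply (n + 1)

lemma measurable_coords (M n : ℕ) : Measurable (fun (ω : ℕ → Fin M) (i : Fin n) => ω i) :=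
  measurable_pi_lambda _ fun i => measurable_pi_apply (i : ℕ)

lemma coords_preimage (M : ℕ) {n : ℕ} (w : Fin n → Fin M) :
    (fun (ω : ℕ → Fin M) (i : Fin n) => ω i) ⁻¹' {w} = cylW M w := by
  ext ω
  simp [cylW, funext_iff]

lemma measurableSet_cylW (M : ℕ) {n : ℕ} (w : Fin n → Fin M) : MeasurableSet (cylW M w) := by
  rw [← coords_preimage]
  exact measurable_coords M n (measurableSet_singleton w)

lemma blockEnt_eq (M n : ℕ) (μ : Measure (ℕ → Fin M)) :
    blockEnt M n μ = ∑ w : Fin n → Fin M, Real.negMulLog (μ.real (cylW M w)) := by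
  simp only [blockEnt, entOf, coords_preimage]

lemma entS_eq (M : ℕ) (μ : Measure (ℕ → Fin M)) :
    entS M μ = liminf (fun n : ℕ => (n : ℝ)⁻¹ * blockEnt M n μ) atTop := by
  simp only [blockEnt_eq]
  rfl

lemma entOf_map {Ω Ω' α : Type*} [MeasurableSpace Ω] [MeasurableSpace Ω'] [Fintype α]
    [MeasurableSpace α] [MeasurableSingletonClass α] (μ : Measure Ω) {f : Ω → Ω'}
    (hf : Measurable f) {X : Ω' → α} (hX : Measurable X) :
    entOf (μ.map f) X = entOf μ (fun ω => X (f ω)) := by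
  unfold entOf
  refine Finset.sum_congr rfl fun a _ => ?_
  rw [map_measureReal_apply hf (hX (measurableSet_singleton a))]
  rfl

lemma blockEnt_mono (M : ℕ) {n m : ℕ} (h : n ≤ m) (ρ : Measure (ℕ → Fin M))
    [IsFiniteMeasure ρ] : blockEnt M n ρ ≤ blockEnt M m ρ :=
  entOf_comp_le ρ (measurable_coords M m) (fun w (i : Fin n) => w (Fin.castLE h i))

lemma blockEnt_add_le (M n m : ℕ) (ρ : Measure (ℕ → Fin M)) [IsProbabilityMeasure ρ] :
    blockEnt M (n + m) ρ ≤ blockEnt M n ρ + blockEnt M m (ρ.map (shiftMap M)^[n]) := by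
  have hs : Measurable (shiftMap M)^[n] := (measurable_shiftMap M).iterate n
  have hX := measurable_coords M n
  have hY := (measurable_coords M m).comp hs
  rw [blockEnt, blockEnt, blockEnt, entOf_map ρ hs (measurable_coords M m)]
  refine le_trans (le_of_eq ?_) ((entOf_comp_le ρ (hX.prodMk hY)
    (fun p => Fin.append p.1 p.2)).trans (entOf_prod_le ρ hX hY))
  congr 1
  funext ω i
  refine Fin.addCases (fun i => ?_) (fun i => ?_) i
  · simp
  · simp [shiftMap_iterate_apply, add_comm]

section Invariant

variable {M : ℕ} {μ : Measure (ℕ → Fin M)} [IsProbabilityMeasure μ]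

lemma blockEnt_subadditive (h : MeasurePreserving (shiftMap M) μ μ) :
    Subadditive (fun n => blockEnt M n μ) := fun m n => by
  simpa [(h.iterate m).map_eq] using blockEnt_add_le M m n μ

lemma bddBelow_blockEnt_div (μ : Measure (ℕ → Fin M)) [IsProbabilityMeasure μ] :
    BddBelow (range fun n : ℕ => blockEnt M n μ / n) := by
  refine ⟨0, ?_⟩
  rintro _ ⟨n, rfl⟩
  exact div_nonneg (entOf_nonneg μ _) (Nat.cast_nonneg n)

lemma entS_eq_lim (h : MeasurePreserving (shiftMap M) μ μ) :
    entS M μ = (blockEnt_subadditive h).lim := by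
  rw [entS_eq]
  simp only [inv_mul_eq_div]
  exact ((blockEnt_subadditive h).tendsto_lim (bddBelow_blockEnt_div μ)).liminf_eq

lemma tendsto_entS (h : MeasurePreserving (shiftMap M) μ μ) :
    Tendsto (fun n : ℕ => blockEnt M n μ / n) atTop (nhds (entS M μ)) := by
  rw [entS_eq_lim h]
  exact (blockEnt_subadditive h).tendsto_lim (bddBelow_blockEnt_div μ)

lemma entS_le_div (h : MeasurePreserving (shiftMap M) μ μ) {n : ℕ} (hn : n ≠ 0) :
    entS M μ ≤ blockEnt M n μ / n := by
  rw [entS_eq_lim h]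
  exact (blockEnt_subadditive h).lim_le_div (bddBelow_blockEnt_div μ) hn

lemma entS_nonneg (h : MeasurePreserving (shiftMap M) μ μ) : 0 ≤ entS M μ :=
  ge_of_tendsto' (tendsto_entS h) fun n => div_nonneg (entOf_nonneg μ _) (Nat.cast_nonneg n)

lemma blockEnt_le_mul_log (n : ℕ) (ρ : Measure (ℕ → Fin M)) [IsProbabilityMeasure ρ] :
    blockEnt M n ρ ≤ n * Real.log M := by
  refine (entOf_le_log_card ρ (measurable_coords M n)).trans (le_of_eq ?_)
  simp

lemma entS_le_log (h : MeasurePreserving (shiftMap M) μ μ) : entS M μ ≤ Real.log M := by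
  refine (entS_le_div h one_ne_zero).trans ?_
  simpa using blockEnt_le_mul_log 1 μ

/-- Upper semicontinuity of the entropy, quantitatively in terms of cylinders. -/
lemma exists_entS_lt (h : MeasurePreserving (shiftMap M) μ μ) {ε : ℝ} (hε : 0 < ε) :
    ∃ n : ℕ, ∃ δ : ℝ, 0 < δ ∧ ∀ ν : Measure (ℕ → Fin M), IsProbabilityMeasure ν →
      MeasurePreserving (shiftMap M) ν ν →
      (∀ w : Fin n → Fin M, |ν.real (cylW M w) - μ.real (cylW M w)| < δ) →
      entS M ν < entS M μ + ε := by
  obtain ⟨n, hn, hn0⟩ := (((tendsto_entS h).eventually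
    (gt_mem_nhds (lt_add_of_pos_right _ hε))).and (eventually_gt_atTop 0)).exists
  have hcont : Continuous fun x : (Fin n → Fin M) → ℝ => (∑ w, Real.negMulLog (x w)) / n := by
    fun_prop
  have hopen := hcont.isOpen_preimage _ (isOpen_Iio (a := entS M μ + ε))
  have hmem : (fun w => μ.real (cylW M w)) ∈
      (fun x : (Fin n → Fin M) → ℝ => (∑ w, Real.negMulLog (x w)) / n) ⁻¹'
        Iio (entS M μ + ε) := by
    simpa [← blockEnt_eq] using hn
  obtain ⟨δ, hδ, hball⟩ := Metric.isOpen_iff.1 hopen _ hmem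
  refine ⟨n, δ, hδ, fun ν hν hinv hw => ?_⟩
  refine (entS_le_div hinv hn0.ne').trans_lt ?_
  have : (fun w : Fin n → Fin M => ν.real (cylW M w)) ∈
      Metric.ball (fun w : Fin n → Fin M => μ.real (cylW M w)) δ := by
    rw [Metric.mem_ball, dist_pi_lt_iff hδ]
    exact fun w => hw w
  have := hball this
  simpa [← blockEnt_eq] using this

lemma sum_mul_entS_le {ι : Type*} [Fintype ι] {c : ι → ℝ} (hc : ∀ i, 0 ≤ c i)
    (hc1 : ∑ i, c i = 1) {ν : ι → Measure (ℕ → Fin M)} (hνp : ∀ i, IsProbabilityMeasure (ν i))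
    (hν : ∀ i, MeasurePreserving (shiftMap M) (ν i) (ν i))
    (hμ : MeasurePreserving (shiftMap M) μ μ)
    (h : ∀ S, MeasurableSet S → μ.real S = ∑ i, c i * (ν i).real S) :
    ∑ i, c i * entS M (ν i) ≤ entS M μ := by
  refine le_of_tendsto_of_tendsto' (tendsto_finsetSum _ fun i _ =>
    (tendsto_entS (hν i)).const_mul (c i)) (tendsto_entS hμ) fun n => ?_
  have := sum_mul_entOf_le hc hc1 (measurable_coords M n) h
  simp_rw [← mul_div_assoc, ← Finset.sum_div]
  exact div_le_div_of_nonneg_right this (Nat.cast_nonneg n)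

end Invariant

lemma infinitePi_forall_eq {W : Type*} [MeasurableSpace W] [MeasurableSingletonClass W]
    (P : Measure W) [IsProbabilityMeasure P] (c r : ℕ) (L : Fin r → W) :
    Measure.infinitePi (fun _ : ℕ => P) {x | ∀ a : Fin r, x (a + c) = L a} = ∏ a, P {L a} := by
  let f : Fin r ↪ ℕ := ⟨fun a => a + c, fun a b h => Fin.ext (by simpa using h)⟩
  let t : ℕ → Set W := fun n => if h : n - c < r then {L ⟨n - c, h⟩} else univ
  have ht : ∀ a, t (f a) = {L a} := fun a => by
    have : (a : ℕ) + c - c < r := by rw [Nat.add_sub_cancel]; exact a.2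
    change (if h : (a : ℕ) + c - c < r then ({L ⟨_, h⟩} : Set W) else univ) = _
    rw [dif_pos this]
    simp
  have hS : {x : ℕ → W | ∀ a : Fin r, x (a + c) = L a} =
      Set.pi (Finset.univ.map f : Finset ℕ) t := by
    ext x
    simp [Set.mem_pi, ht]
    rfl
  have hm : ∀ n, MeasurableSet (t n) := fun n => by
    simp only [t]
    split_ifs
    · exact measurableSet_singleton _
    · exact MeasurableSet.univ
  rw [hS, Measure.infinitePi_pi _ (fun i _ => hm i), Finset.prod_map]
  simp only [ht]

lemma infinitePi_map_succ {W : Type*} [MeasurableSpace W] (P : Measure W)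
    [IsProbabilityMeasure P] :
    (Measure.infinitePi (fun _ : ℕ => P)).map (fun x n => x (n + 1)) =
      Measure.infinitePi (fun _ : ℕ => P) := by
  refine Measure.eq_infinitePi _ fun s t ht => ?_
  have hmeas : Measurable (fun (x : ℕ → W) (n : ℕ) => x (n + 1)) :=
    measurable_pi_lambda _ fun n => measurable_pi_apply (n + 1)
  rw [Measure.map_apply hmeas (MeasurableSet.pi s.countable_toSet fun i _ => ht i)]
  have : (fun (x : ℕ → W) (n : ℕ) => x (n + 1)) ⁻¹' Set.pi s t =
      Set.pi (s.map ⟨Nat.succ, Nat.succ_injective⟩ : Finset ℕ) (fun n => t (n - 1)) := by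
    ext x
    simp [Set.mem_pi]
  rw [this, Measure.infinitePi_pi _ (fun i _ => ht _), Finset.prod_map]
  simp

lemma sum_negMulLog_prod_eq {W : Type*} [Fintype W] (p : W → ℝ) (hp : ∑ w, p w = 1) (r : ℕ) :
    ∑ L : Fin r → W, Real.negMulLog (∏ a, p (L a)) = r * ∑ w, Real.negMulLog (p w) := by
  induction r with
  | zero => simp
  | succ r ih =>
    have h1 : ∑ L : Fin r → W, ∏ a, p (L a) = 1 := by
      rw [← Fintype.prod_sum (fun (_ : Fin r) w => p w)]
      simp [hp]
    rw [← (Fin.consEquiv (fun _ : Fin (r + 1) => W)).sum_comp, Fintype.sum_prod_type]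
    simp only [Fin.consEquiv_apply, Fin.prod_univ_succ, Fin.cons_zero, Fin.cons_succ,
      Real.negMulLog_mul, Finset.sum_add_distrib, ← Finset.sum_mul, ← Finset.mul_sum, h1, hp, ih]
    push_cast
    ring

lemma entOf_infinitePi {W : Type*} [Fintype W] [MeasurableSpace W] [MeasurableSingletonClass W]
    (P : Measure W) [IsProbabilityMeasure P] (c r : ℕ) :
    entOf (Measure.infinitePi (fun _ : ℕ => P)) (fun x (a : Fin r) => x (a + c)) =
      r * entOf P id := by
  have h1 : ∑ w, P.real {w} = 1 := by
    exact sum_real_preimage P (measurable_id (α := W))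
  unfold entOf
  simp only [Set.preimage_id]
  rw [← sum_negMulLog_prod_eq _ h1]
  refine Finset.sum_congr rfl fun L _ => ?_
  congr 1
  have : (fun (x : ℕ → W) (a : Fin r) => x (a + c)) ⁻¹' {L} =
      {x | ∀ a : Fin r, x (a + c) = L a} := by
    ext x; simp [funext_iff]
  simp only [measureReal_def, this, infinitePi_forall_eq, ENNReal.toReal_prod]

lemma entOf_congr_ae {Ω α : Type*} [MeasurableSpace Ω] [Fintype α] {μ : Measure Ω}
    {X Y : Ω → α} (h : X =ᵐ[μ] Y) : entOf μ X = entOf μ Y := by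
  unfold entOf
  refine Finset.sum_congr rfl fun a _ => ?_
  rw [measureReal_def, measureReal_def, measure_congr]
  filter_upwards [h] with ω hω
  refine propext ?_
  change X ω = a ↔ Y ω = a
  rw [hω]

/-- Concatenate words of length `t + 1`, each overlapping the next one in a symbol. -/
def blockConcat (M t : ℕ) (x : ℕ → (Fin (t + 1) → Fin M)) : ℕ → Fin M :=
  fun n => x (n / t) (Fin.ofNat (t + 1) (n % t))

lemma measurable_blockConcat (M t : ℕ) : Measurable (blockConcat M t) :=
  measurable_pi_lambda _ fun n =>
    (measurable_pi_apply (Fin.ofNat (t + 1) (n % t))).comp (measurable_pi_apply (n / t))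

lemma blockConcat_apply_of_lt {M t : ℕ} (x : ℕ → (Fin (t + 1) → Fin M)) (a : ℕ) {b : ℕ}
    (hb : b < t) : blockConcat M t x (a * t + b) = x a ⟨b, by omega⟩ := by
  have ht : 0 < t := by omega
  have h1 : (a * t + b) / t = a := by
    rw [Nat.add_comm, Nat.add_mul_div_right _ _ ht, Nat.div_eq_of_lt hb, zero_add]
  have h2 : (a * t + b) % t = b := by
    rw [Nat.add_comm, Nat.add_mul_mod_self_right, Nat.mod_eq_of_lt hb]
  rw [blockConcat, h1, h2]
  congr 1
  ext
  simp only [Fin.val_ofNat]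
  exact Nat.mod_eq_of_lt (by omega)

lemma blockConcat_apply_of_loops {M t : ℕ} (ht : 1 ≤ t) {j : Fin M}
    {x : ℕ → (Fin (t + 1) → Fin M)} (h0 : ∀ a, x a 0 = j) (h1 : ∀ a, x a (Fin.last t) = j)
    (a : ℕ) (b : Fin (t + 1)) : blockConcat M t x (a * t + b) = x a b := by
  rcases Nat.lt_succ_iff_lt_or_eq.1 b.2 with hb | hb
  · exact blockConcat_apply_of_lt x a hb
  · have : b = Fin.last t := Fin.ext hb
    subst this
    have h2 : a * t + (Fin.last t : ℕ) = (a + 1) * t + 0 := by simp; ring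
    rw [h2, blockConcat_apply_of_lt x (a + 1) (by omega), h1]
    exact h0 _

lemma shiftMap_iterate_blockConcat {M t : ℕ} (ht : 1 ≤ t) (x : ℕ → (Fin (t + 1) → Fin M)) :
    (shiftMap M)^[t] (blockConcat M t x) = blockConcat M t (fun n => x (n + 1)) := by
  funext n
  rw [shiftMap_iterate_apply, blockConcat, blockConcat, Nat.add_div_right _ ht,
    Nat.add_mod_right]

lemma measurePreserving_average {M t : ℕ} (ht : 1 ≤ t) {ν : Measure (ℕ → Fin M)}
    (hν : ν.map (shiftMap M)^[t] = ν) :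
    MeasurePreserving (shiftMap M)
      ((t : ℝ≥0∞)⁻¹ • ∑ k ∈ Finset.range t, ν.map (shiftMap M)^[k])
      ((t : ℝ≥0∞)⁻¹ • ∑ k ∈ Finset.range t, ν.map (shiftMap M)^[k]) := by
  have hs := measurable_shiftMap M
  refine ⟨hs, ?_⟩
  rw [Measure.map_smul]
  congr 1
  ext S hS
  rw [Measure.map_apply hs hS]
  simp only [Measure.finsetSum_apply]
  have key : ∀ k, (ν.map (shiftMap M)^[k]) (shiftMap M ⁻¹' S) =
      (ν.map (shiftMap M)^[k + 1]) S := fun k => by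
    rw [Measure.map_apply (hs.iterate k) (hs hS), Measure.map_apply (hs.iterate (k + 1)) hS,
      Function.iterate_succ']
    rfl
  simp only [key]
  obtain ⟨s, rfl⟩ : ∃ s, t = s + 1 := ⟨t - 1, by omega⟩
  rw [Finset.sum_range_succ, hν, Finset.sum_range_succ']
  simp

lemma isProbabilityMeasure_average {M t : ℕ} (ht : 1 ≤ t) {ν : Measure (ℕ → Fin M)}
    [IsProbabilityMeasure ν] :
    IsProbabilityMeasure ((t : ℝ≥0∞)⁻¹ • ∑ k ∈ Finset.range t, ν.map (shiftMap M)^[k]) := by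
  refine ⟨?_⟩
  have : ∀ k, (ν.map (shiftMap M)^[k]) univ = 1 := fun k => by
    rw [Measure.map_apply ((measurable_shiftMap M).iterate k) MeasurableSet.univ]
    simp
  simp only [Measure.smul_apply, Measure.finsetSum_apply, this, Finset.sum_const,
    Finset.card_range, smul_eq_mul, nsmul_eq_mul, mul_one]
  exact ENNReal.inv_mul_cancel (by simp; omega) (by simp)

lemma average_real_apply {M : ℕ} (t : ℕ) {ν : Measure (ℕ → Fin M)}
    [IsProbabilityMeasure ν] (S : Set (ℕ → Fin M)) :
    ((t : ℝ≥0∞)⁻¹ • ∑ k ∈ Finset.range t, ν.map (shiftMap M)^[k]).real S =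
      ∑ k ∈ Finset.range t, (t : ℝ)⁻¹ * (ν.map (shiftMap M)^[k]).real S := by
  simp only [measureReal_def, Measure.smul_apply, Measure.finsetSum_apply, smul_eq_mul,
    ENNReal.toReal_mul, ENNReal.toReal_inv, ENNReal.toReal_natCast]
  rw [ENNReal.toReal_sum, Finset.mul_sum]
  intro k _
  have := Measure.isProbabilityMeasure_map (μ := ν)
    ((measurable_shiftMap M).iterate k).aemeasurable
  exact measure_ne_top _ _

lemma card_mul_sum_abs_le {t m : ℕ} (d : ℕ → ℝ) (hd : ∀ k, |d k| ≤ 1)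
    (h0 : ∀ k, k + m ≤ t → d k = 0) : |∑ k ∈ Finset.range t, d k| ≤ m := by
  refine (Finset.abs_sum_le_sum_abs _ _).trans ?_
  have h1 : ∀ k ∈ Finset.range t, |d k| ≤ if k ∈ Finset.Ico (t - m) t then (1 : ℝ) else 0 := by
    intro k hk
    split_ifs with h
    · exact hd k
    · rw [h0 k, abs_zero]
      simp only [Finset.mem_Ico, Finset.mem_range] at h hk
      omega
  refine (Finset.sum_le_sum h1).trans ?_
  rw [← Finset.sum_filter, Finset.sum_const, nsmul_eq_mul, mul_one]
  have : (Finset.filter (fun k => k ∈ Finset.Ico (t - m) t) (Finset.range t)).card ≤ m := by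
    calc _ ≤ (Finset.Ico (t - m) t).card := Finset.card_le_card fun k hk =>
          (Finset.mem_filter.1 hk).2
      _ ≤ m := by rw [Nat.card_Ico]; omega
  exact_mod_cast this

lemma abs_measureReal_sub_le {Ω Ω' : Type*} [MeasurableSpace Ω] [MeasurableSpace Ω']
    (μ : Measure Ω) (ν : Measure Ω') [IsProbabilityMeasure μ] [IsProbabilityMeasure ν]
    (S : Set Ω) (S' : Set Ω') : |μ.real S - ν.real S'| ≤ 1 := by
  rw [abs_le]
  have h1 := measureReal_nonneg (μ := μ) (s := S)
  have h2 := measureReal_nonneg (μ := ν) (s := S')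
  have h3 := measureReal_le_one (μ := μ) (s := S)
  have h4 := measureReal_le_one (μ := ν) (s := S')
  constructor <;> linarith

lemma measurableSet_loopConcatCyl (M q m : ℕ) (L : Fin m → (Fin (q + 1) → Fin M)) :
    MeasurableSet (loopConcatCyl M q m L) := by
  have : loopConcatCyl M q m L = ⋂ (a : Fin m) (b : Fin (q + 1)),
      (fun ω : ℕ → Fin M => ω ((a : ℕ) * q + (b : ℕ))) ⁻¹' {L a b} := by
    ext ω; simp [loopConcatCyl]
  rw [this]
  exact MeasurableSet.iInter fun a => MeasurableSet.iInter fun b =>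
    measurable_pi_apply _ (measurableSet_singleton _)

/-- The law of the concatenation of independent copies of the first `t + 1` symbols. -/
def loopMeasure (M t : ℕ) (ρ : Measure (ℕ → Fin M)) : Measure (ℕ → Fin M) :=
  (Measure.infinitePi (fun _ : ℕ => ρ.map (fun ω (i : Fin (t + 1)) => ω i))).map
    (blockConcat M t)

section Loop

variable {M : ℕ} {Q : Fin M → Fin M → Bool} {j : Fin M} {t : ℕ} {ρ : Measure (ℕ → Fin M)}
  [IsProbabilityMeasure ρ]

instance isProbabilityMeasure_map_coords (n : ℕ) :
    IsProbabilityMeasure (ρ.map (fun ω (i : Fin n) => ω i)) :=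
  Measure.isProbabilityMeasure_map (measurable_coords M n).aemeasurable

instance isProbabilityMeasure_loopMeasure : IsProbabilityMeasure (loopMeasure M t ρ) :=
  Measure.isProbabilityMeasure_map (measurable_blockConcat M t).aemeasurable

lemma ae_infinitePi_forall {p : (Fin (t + 1) → Fin M) → Prop}
    (h : ∀ᵐ ω ∂ρ, p (fun i => ω i)) :
    ∀ᵐ x ∂(Measure.infinitePi (fun _ : ℕ => ρ.map (fun ω (i : Fin (t + 1)) => ω i))),
      ∀ a, p (x a) := by
  rw [ae_all_iff]
  intro a
  have h1 : ∀ᵐ u ∂(ρ.map (fun ω (i : Fin (t + 1)) => ω i)), p u :=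
    (ae_map_iff (measurable_coords M _).aemeasurable (Set.toFinite _).measurableSet).2 h
  exact (measurePreserving_eval_infinitePi
    (fun _ : ℕ => ρ.map (fun ω (i : Fin (t + 1)) => ω i)) a).quasiMeasurePreserving.ae h1

lemma map_loopMeasure (ht : 1 ≤ t) :
    (loopMeasure M t ρ).map (shiftMap M)^[t] = loopMeasure M t ρ := by
  have hsucc : Measurable (fun (x : ℕ → (Fin (t + 1) → Fin M)) (n : ℕ) => x (n + 1)) :=
    measurable_pi_lambda _ fun n => measurable_pi_apply (n + 1)
  rw [loopMeasure, Measure.map_map ((measurable_shiftMap M).iterate t)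
    (measurable_blockConcat M t)]
  have : (shiftMap M)^[t] ∘ blockConcat M t = blockConcat M t ∘ fun x n => x (n + 1) :=
    funext fun x => shiftMap_iterate_blockConcat ht x
  rw [this, ← Measure.map_map (measurable_blockConcat M t) hsucc, infinitePi_map_succ]

lemma loopMeasure_cylW {m k : ℕ} (w : Fin m → Fin M) (hk : k + m ≤ t) :
    ((loopMeasure M t ρ).map (shiftMap M)^[k]).real (cylW M w) =
      ρ.real ((shiftMap M)^[k] ⁻¹' cylW M w) := by
  have hs := (measurable_shiftMap M).iterate k
  have hc := measurableSet_cylW M w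
  let S : Set (Fin (t + 1) → Fin M) := {u | ∀ i : Fin m, u ⟨i + k, by omega⟩ = w i}
  have hS : MeasurableSet S := (Set.toFinite _).measurableSet
  rw [map_measureReal_apply hs hc, loopMeasure,
    map_measureReal_apply (measurable_blockConcat M t) (hs hc)]
  have h1 : blockConcat M t ⁻¹' ((shiftMap M)^[k] ⁻¹' cylW M w) = Function.eval 0 ⁻¹' S := by
    ext x
    simp only [Set.mem_preimage, cylW, Set.mem_ofPred_eq, shiftMap_iterate_apply, S,
      Function.eval]
    refine forall_congr' fun i => ?_
    have := blockConcat_apply_of_lt x 0 (b := (i : ℕ) + k) (by omega)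
    rw [zero_mul, zero_add] at this
    rw [this]
  have h2 : (shiftMap M)^[k] ⁻¹' cylW M w = (fun ω (i : Fin (t + 1)) => ω i) ⁻¹' S := by
    ext ω
    simp [cylW, S, shiftMap_iterate_apply]
  rw [h1, h2, ← map_measureReal_apply (measurable_pi_apply 0) hS, Measure.infinitePi_map_eval,
    map_measureReal_apply (measurable_coords M (t + 1)) hS]

lemma blockEnt_loopMeasure_ge (ht : 1 ≤ t) (h0 : ∀ᵐ ω ∂ρ, ω 0 = j) (h1 : ∀ᵐ ω ∂ρ, ω t = j)
    (r : ℕ) {k : ℕ} (hk : k < t) :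
    r * blockEnt M (t + 1) ρ ≤
      blockEnt M ((r + 1) * t + 1) ((loopMeasure M t ρ).map (shiftMap M)^[k]) := by
  have hs := (measurable_shiftMap M).iterate k
  have hb := measurable_blockConcat M t
  have he : blockEnt M (t + 1) ρ =
      entOf (ρ.map (fun ω (i : Fin (t + 1)) => ω i)) id := by
    rw [entOf_map ρ (measurable_coords M (t + 1)) measurable_id]
    rfl
  have hlt : ∀ (a : Fin r) (b : Fin (t + 1)), ((a : ℕ) + 1) * t + b - k < (r + 1) * t + 1 := by
    intro a b
    have h2 : ((a : ℕ) + 1) * t ≤ r * t := Nat.mul_le_mul_right t a.2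
    have h3 : (r + 1) * t = r * t + t := by ring
    omega
  rw [he, ← entOf_infinitePi _ 1 r, blockEnt, loopMeasure, Measure.map_map hs hb,
    entOf_map _ (hs.comp hb) (measurable_coords M _)]
  refine le_trans (le_of_eq ?_) (entOf_comp_le _ ((measurable_coords M _).comp (hs.comp hb))
    (fun (w : Fin ((r + 1) * t + 1) → Fin M) (a : Fin r) (b : Fin (t + 1)) =>
      w ⟨((a : ℕ) + 1) * t + b - k, hlt a b⟩))
  refine entOf_congr_ae ?_
  filter_upwards [ae_infinitePi_forall (p := fun u => u 0 = j) h0,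
    ae_infinitePi_forall (p := fun u => u (Fin.last t) = j) h1] with x hx0 hx1
  funext a b
  have h2 : t ≤ ((a : ℕ) + 1) * t := Nat.le_mul_of_pos_left t (Nat.succ_pos _)
  simp only [Function.comp, shiftMap_iterate_apply]
  rw [Nat.sub_add_cancel (by omega), blockConcat_apply_of_loops ht hx0 hx1]

lemma loopMeasure_loopConcatCyl (ht : 1 ≤ t) (h0 : ∀ᵐ ω ∂ρ, ω 0 = j)
    (h1 : ∀ᵐ ω ∂ρ, ω t = j) (m : ℕ) (L : Fin m → (Fin (t + 1) → Fin M)) :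
    loopMeasure M t ρ (loopConcatCyl M t m L) = ∏ a, ρ (cylW M (L a)) := by
  have hP : ∀ w : Fin (t + 1) → Fin M,
      ρ (cylW M w) = ρ.map (fun ω (i : Fin (t + 1)) => ω i) {w} := fun w => by
    rw [Measure.map_apply (measurable_coords M _) (measurableSet_singleton w), coords_preimage]
  simp only [hP]
  rw [← infinitePi_forall_eq _ 0 m L, loopMeasure, Measure.map_apply (measurable_blockConcat M t)
    (measurableSet_loopConcatCyl M t m L)]
  refine measure_congr ?_
  filter_upwards [ae_infinitePi_forall (p := fun u => u 0 = j) h0,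
    ae_infinitePi_forall (p := fun u => u (Fin.last t) = j) h1] with x hx0 hx1
  refine propext ?_
  change (∀ (a : Fin m) (b : Fin (t + 1)), blockConcat M t x ((a : ℕ) * t + (b : ℕ)) = L a b) ↔
    (∀ a : Fin m, x (a + 0) = L a)
  simp only [blockConcat_apply_of_loops ht hx0 hx1, add_zero, funext_iff]

lemma exists_isQStepBernoulli (ht : 1 ≤ t) (hQ : ∀ᵐ ω ∂ρ, ω ∈ SigmaQ M Q)
    (h0 : ∀ᵐ ω ∂ρ, ω 0 = j) (h1 : ∀ᵐ ω ∂ρ, ω t = j) :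
    ∃ ν : Measure (ℕ → Fin M), IsQStepBernoulli M Q ν j t ∧ IsProbabilityMeasure ν ∧
      MeasurePreserving (shiftMap M) ν ν ∧ blockEnt M (t + 1) ρ ≤ t * entS M ν ∧
      ∀ (m : ℕ) (w : Fin m → Fin M),
        |ν.real (cylW M w) - ∑ k ∈ Finset.range t,
          (t : ℝ)⁻¹ * ρ.real ((shiftMap M)^[k] ⁻¹' cylW M w)| ≤ m / t := by
  have ht0 : (0 : ℝ) < t := by exact_mod_cast ht
  have hloop : ∀ᵐ ω ∂ρ, IsLoop M Q t j (fun i => ω i) := by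
    filter_upwards [hQ, h0, h1] with ω hω hω0 hω1
    exact ⟨hω0, hω1, fun l => hω l⟩
  have hprob := isProbabilityMeasure_average (M := M) ht (ν := loopMeasure M t ρ)
  have hinv := measurePreserving_average ht (map_loopMeasure (M := M) (ρ := ρ) ht)
  have hmapprob : ∀ k, IsProbabilityMeasure ((loopMeasure M t ρ).map (shiftMap M)^[k]) := fun k =>
    Measure.isProbabilityMeasure_map ((measurable_shiftMap M).iterate k).aemeasurable
  refine ⟨_, ⟨ht, ?_, fun w => ρ (cylW M w), loopMeasure M t ρ, ?_, ?_, inferInstance,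
    fun m L _ => loopMeasure_loopConcatCyl ht h0 h1 m L, rfl⟩, hprob, hinv, ?_, ?_⟩
  · obtain ⟨ω, hω⟩ := hloop.exists
    exact ⟨t, ht, fun i => ω i, hω.1, hω.2.1, hω.2.2⟩
  · intro w hw
    rw [measure_eq_zero_iff_ae_notMem]
    filter_upwards [hloop] with ω hl hω
    refine hw ?_
    have : (fun i : Fin (t + 1) => ω i) = w := funext hω
    exact this ▸ hl
  · have := sum_real_preimage ρ (measurable_coords M (t + 1))
    simp only [coords_preimage] at this
    rw [← ENNReal.toReal_eq_one_iff, ENNReal.toReal_sum fun _ _ => measure_ne_top _ _]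
    exact this
  · set ν := (t : ℝ≥0∞)⁻¹ • ∑ k ∈ Finset.range t, (loopMeasure M t ρ).map (shiftMap M)^[k]
    have hsub : Tendsto (fun r : ℕ => (r + 1) * t + 1) atTop atTop :=
      tendsto_atTop_mono (fun r => by
        have := Nat.le_mul_of_pos_right (r + 1) ht
        simp only [id]
        omega) tendsto_id
    have hlim := (tendsto_const_nhds (x := (t : ℝ))).add
      (tendsto_const_div_atTop_nhds_zero_nat ((t : ℝ) + 1)) |>.mul ((tendsto_entS hinv).comp hsub)
    rw [add_zero] at hlim
    refine ge_of_tendsto hlim ?_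
    filter_upwards [eventually_gt_atTop 0] with r hr
    have hr0 : (0 : ℝ) < r := by exact_mod_cast hr
    have hge : r * blockEnt M (t + 1) ρ ≤ blockEnt M ((r + 1) * t + 1) ν := by
      have hconv := sum_mul_entOf_le (c := fun _ : Fin t => (t : ℝ)⁻¹)
        (ν := fun k : Fin t => (loopMeasure M t ρ).map (shiftMap M)^[(k : ℕ)]) (ρ := ν)
        (fun _ => inv_nonneg.2 ht0.le) (by simp [ht0.ne'])
        (measurable_coords M ((r + 1) * t + 1)) (fun S _ => by
          rw [average_real_apply, Finset.sum_range])
      refine le_trans ?_ hconv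
      calc r * blockEnt M (t + 1) ρ
          = ∑ k : Fin t, (t : ℝ)⁻¹ * (r * blockEnt M (t + 1) ρ) := by
            simp [ht0.ne']
        _ ≤ _ := Finset.sum_le_sum fun k _ => mul_le_mul_of_nonneg_left
            (blockEnt_loopMeasure_ge ht h0 h1 r k.2) (inv_nonneg.2 ht0.le)
    simp only [Function.comp]
    push_cast
    have heq : ((t : ℝ) + (t + 1) / r) *
        (blockEnt M ((r + 1) * t + 1) ν / (((r : ℝ) + 1) * t + 1)) =
        blockEnt M ((r + 1) * t + 1) ν / r := by
      field_simp
      ring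
    rw [heq, le_div_iff₀ hr0, mul_comm]
    exact hge
  · intro m w
    rw [average_real_apply, ← Finset.sum_sub_distrib]
    simp_rw [← mul_sub]
    rw [← Finset.mul_sum, abs_mul, abs_of_pos (inv_pos.2 ht0), inv_mul_eq_div]
    refine div_le_div_of_nonneg_right (card_mul_sum_abs_le _ (fun k => ?_) fun k hk => ?_) ht0.le
    · exact abs_measureReal_sub_le _ _ _ _
    · rw [loopMeasure_cylW w hk, sub_self]

end Loop

section Return

variable {M : ℕ} {μ : Measure (ℕ → Fin M)} [IsProbabilityMeasure μ]

lemma exists_return_symbol (h : MeasurePreserving (shiftMap M) μ μ) (j : Fin M) {ε : ℝ}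
    (hε : 0 < ε) : ∃ L₀ : ℕ, ∀ L ≥ L₀, ∀ T : ℕ,
      μ.real {ω | ω 0 = j ∧ ∀ i ≤ L, ω (T + i) ≠ j} ≤ ε := by
  let D : ℕ → Set (ℕ → Fin M) := fun L => {ω | ∀ i ≤ L, ω i ≠ j}
  let E : Set (ℕ → Fin M) := {ω | ∀ i, ω i ≠ j}
  have hne : ∀ i, MeasurableSet {ω : ℕ → Fin M | ω i ≠ j} := fun i => by
    have : MeasurableSet ((fun ω : ℕ → Fin M => ω i) ⁻¹' {j}ᶜ) :=
      measurable_pi_apply i (measurableSet_singleton j).compl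
    exact this
  have hDm : ∀ L, MeasurableSet (D L) := fun L => by
    have : D L = ⋂ i, ⋂ (_ : i ≤ L), {ω : ℕ → Fin M | ω i ≠ j} := by ext; simp [D]
    rw [this]
    exact MeasurableSet.iInter fun i => MeasurableSet.iInter fun _ => hne i
  have hEm : MeasurableSet E := by
    have : E = ⋂ i, {ω : ℕ → Fin M | ω i ≠ j} := by ext; simp [E]
    rw [this]
    exact MeasurableSet.iInter hne
  have hDE : ⋂ L, D L = E := by
    ext ω
    simp only [D, E, Set.mem_iInter, Set.mem_ofPred_eq]
    exact ⟨fun hω i => hω i i le_rfl, fun hω _ i _ => hω i⟩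
  have hanti : Antitone D := fun a b hab ω hω i hi => hω i (hi.trans hab)
  have hlim : Tendsto (fun L => μ.real (D L)) atTop (nhds (μ.real E)) := by
    have := tendsto_measure_iInter_atTop (μ := μ) (fun L => (hDm L).nullMeasurableSet) hanti
      ⟨0, measure_ne_top _ _⟩
    rw [hDE] at this
    exact (ENNReal.tendsto_toReal (measure_ne_top _ _)).comp this
  obtain ⟨L₀, hL₀⟩ := eventually_atTop.1 (hlim.eventually
    (gt_mem_nhds (lt_add_of_pos_right (μ.real E) hε)))
  refine ⟨L₀, fun L hL T => ?_⟩
  have hT := h.iterate T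
  have hsub : {ω : ℕ → Fin M | ω 0 = j ∧ ∀ i ≤ L, ω (T + i) ≠ j} ⊆
      (shiftMap M)^[T] ⁻¹' (D L \ E) ∪ ((shiftMap M)^[T] ⁻¹' E \ E) := by
    rintro ω ⟨h0, hω⟩
    have h1 : (shiftMap M)^[T] ω ∈ D L := fun i hi => by
      rw [shiftMap_iterate_apply, add_comm]; exact hω i hi
    have h2 : ω ∉ E := fun hE => hE 0 h0
    by_cases h3 : (shiftMap M)^[T] ω ∈ E
    · exact Or.inr ⟨h3, h2⟩
    · exact Or.inl ⟨h1, h3⟩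
  have hEsub : E ⊆ (shiftMap M)^[T] ⁻¹' E := fun ω hω i => by
    rw [shiftMap_iterate_apply]; exact hω _
  have hEsubD : E ⊆ D L := fun ω hω i _ => hω i
  have e1 : μ.real ((shiftMap M)^[T] ⁻¹' (D L \ E)) = μ.real (D L) - μ.real E := by
    rw [hT.measureReal_preimage ((hDm L).diff hEm).nullMeasurableSet,
      measureReal_sdiff hEsubD hEm]
  have e2 : μ.real ((shiftMap M)^[T] ⁻¹' E \ E) = 0 := by
    rw [measureReal_sdiff hEsub hEm, hT.measureReal_preimage hEm.nullMeasurableSet, sub_self]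
  have := (measureReal_mono hsub).trans (measureReal_union_le (μ := μ) _ _)
  have h4 := hL₀ L hL
  linarith

/-- Up to small probability, the initial symbol recurs in every window of a fixed length. -/
lemma exists_return (h : MeasurePreserving (shiftMap M) μ μ) {ε : ℝ} (hε : 0 < ε) :
    ∃ L : ℕ, ∀ T : ℕ, μ.real {ω | ∀ i ≤ L, ω (T + i) ≠ ω 0} ≤ ε := by
  choose L hL using fun j : Fin M => exists_return_symbol h j
    (show 0 < ε / (M + 1) by positivity)
  refine ⟨Finset.univ.sup L, fun T => ?_⟩
  have hsub : {ω : ℕ → Fin M | ∀ i ≤ Finset.univ.sup L, ω (T + i) ≠ ω 0} ⊆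
      ⋃ j ∈ (Finset.univ : Finset (Fin M)),
        {ω | ω 0 = j ∧ ∀ i ≤ Finset.univ.sup L, ω (T + i) ≠ j} := by
    intro ω hω
    simp only [Set.mem_iUnion]
    exact ⟨ω 0, Finset.mem_univ _, rfl, hω⟩
  refine (measureReal_mono hsub (measure_ne_top _ _)).trans
    ((measureReal_biUnion_finset_le _ _).trans ?_)
  refine (Finset.sum_le_sum fun j _ => hL j _ (Finset.le_sup (Finset.mem_univ j)) T).trans ?_
  rw [Finset.sum_const, Finset.card_univ, Fintype.card_fin, nsmul_eq_mul, mul_div_assoc',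
    div_le_iff₀ (by positivity)]
  nlinarith

end Return

lemma real_mul_cond {Ω : Type*} [MeasurableSpace Ω] (μ : Measure Ω) [IsFiniteMeasure μ]
    {A : Set Ω} (hA : MeasurableSet A) (S : Set Ω) :
    μ.real A * (ProbabilityTheory.cond μ A).real S = μ.real (A ∩ S) := by
  by_cases h0 : μ.real A = 0
  · rw [h0, zero_mul, eq_comm]
    exact le_antisymm (h0 ▸ measureReal_mono Set.inter_subset_left) measureReal_nonneg
  · rw [measureReal_def (ProbabilityTheory.cond μ A), ProbabilityTheory.cond_apply hA,
      ENNReal.toReal_mul, ENNReal.toReal_inv]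
    simp only [measureReal_def] at h0 ⊢
    field_simp

lemma abs_average_sub_average_le {T t L : ℕ} (hT : 0 < T) (hTt : T ≤ t) (htL : t ≤ T + L)
    (a : ℕ → ℝ) (h0 : ∀ k, 0 ≤ a k) (h1 : ∀ k, a k ≤ 1) :
    |∑ k ∈ Finset.range t, (t : ℝ)⁻¹ * a k - ∑ k ∈ Finset.range T, (T : ℝ)⁻¹ * a k| ≤ L / T := by
  have hT0 : (0 : ℝ) < T := by exact_mod_cast hT
  have ht0 : (0 : ℝ) < t := by exact_mod_cast hT.trans_le hTt
  have hTt' : (T : ℝ) ≤ t := by exact_mod_cast hTt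
  have htL' : (t : ℝ) - T ≤ L := by
    have : (t : ℝ) ≤ T + L := by exact_mod_cast htL
    linarith
  rw [← Finset.mul_sum, ← Finset.mul_sum, ← Finset.sum_range_add_sum_Ico a hTt]
  set x := ∑ k ∈ Finset.range T, a k
  set y := ∑ k ∈ Finset.Ico T t, a k
  have hx0 : 0 ≤ x := Finset.sum_nonneg fun k _ => h0 k
  have hy0 : 0 ≤ y := Finset.sum_nonneg fun k _ => h0 k
  have hx1 : x ≤ T := by
    simpa using Finset.sum_le_card_nsmul (Finset.range T) a 1 fun k _ => h1 k
  have hy1 : y ≤ t - T := by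
    have := Finset.sum_le_card_nsmul (Finset.Ico T t) a 1 fun k _ => h1 k
    rw [Nat.card_Ico, nsmul_eq_mul, mul_one, Nat.cast_sub hTt] at this
    exact this
  have e : (t : ℝ)⁻¹ * (x + y) - (T : ℝ)⁻¹ * x = (T * y - (t - T) * x) / (t * T) := by
    field_simp
    ring
  rw [e, abs_div, abs_of_pos (mul_pos ht0 hT0), div_le_div_iff₀ (mul_pos ht0 hT0) hT0]
  have hb : |T * y - (t - T) * x| ≤ t * (t - T) := by
    rw [abs_le]
    constructor <;> nlinarith
  calc _ ≤ (t : ℝ) * (t - T) * T := mul_le_mul_of_nonneg_right hb hT0.le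
    _ ≤ t * L * T := by gcongr
    _ = _ := by ring

section

/-- A finite-valued measurable function recording the initial symbol and the time of a return to
it in the window `[T, T + L]`, if there is one. -/
lemma exists_return_code (M T L : ℕ) :
    ∃ C : (ℕ → Fin M) → Option (Fin M × Fin (L + 1)),
      (∀ c, MeasurableSet (C ⁻¹' {c})) ∧
      (∀ ω j i, C ω = some (j, i) → ω 0 = j ∧ ω (T + i) = j) ∧
      (∀ ω, C ω = none → ∀ i ≤ L, ω (T + i) ≠ ω 0) := by
  classical
  let g : (Fin (T + L + 1) → Fin M) → Option (Fin M × Fin (L + 1)) := fun u =>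
    if h : ∃ i : Fin (L + 1), u ⟨T + i, by omega⟩ = u 0 then some (u 0, h.choose) else none
  refine ⟨fun ω => g fun i => ω i, fun c => ?_, fun ω j i h => ?_, fun ω h i hi => ?_⟩
  · exact measurable_coords M (T + L + 1) (Set.toFinite (g ⁻¹' {c})).measurableSet
  · by_cases hex : ∃ i : Fin (L + 1), ω (T + i) = ω 0
    · have h' : g (fun i => ω i) = some (ω 0, hex.choose) := dif_pos hex
      simp only [h', Option.some.injEq, Prod.mk.injEq] at h
      refine ⟨h.1, ?_⟩
      rw [← h.2, ← h.1]
      exact hex.choose_spec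
    · have h' : g (fun i => ω i) = none := dif_neg hex
      simp [h'] at h
  · intro hi'
    have hex : ∃ i : Fin (L + 1), ω (T + i) = ω 0 := ⟨⟨i, by omega⟩, hi'⟩
    have h' : g (fun i => ω i) = some (ω 0, hex.choose) := dif_pos hex
    simp [h'] at h

variable {M : ℕ} {Q : Fin M → Fin M → Bool} {μ : Measure (ℕ → Fin M)} [IsProbabilityMeasure μ]

/-- The `q`-step Bernoulli measure associated with a set of points returning at a common time. -/
lemma exists_isQStepBernoulli_of_return (hQ : ∀ᵐ ω ∂μ, ω ∈ SigmaQ M Q) {A : Set (ℕ → Fin M)}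
    (hA : MeasurableSet A) (hA0 : μ A ≠ 0) {j : Fin M} {T i L : ℕ} (hT : 0 < T) (hi : i ≤ L)
    (hret : ∀ ω ∈ A, ω 0 = j ∧ ω (T + i) = j) :
    ∃ ν : Measure (ℕ → Fin M), (∃ j q, IsQStepBernoulli M Q ν j q) ∧ IsProbabilityMeasure ν ∧
      MeasurePreserving (shiftMap M) ν ν ∧
      blockEnt M T (ProbabilityTheory.cond μ A) ≤ (T + L) * entS M ν ∧
      ∀ n (w : Fin n → Fin M), |μ.real A * ν.real (cylW M w) -
        ∑ k ∈ Finset.range T, (T : ℝ)⁻¹ * μ.real (A ∩ (shiftMap M)^[k] ⁻¹' cylW M w)| ≤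
          μ.real A * ((n + L) / T) := by
  have := ProbabilityTheory.cond_isProbabilityMeasure hA0
  have hmem : ∀ᵐ ω ∂(ProbabilityTheory.cond μ A), ω ∈ A := ProbabilityTheory.ae_cond_mem hA
  obtain ⟨ν, hB, hp, hinv, hent, hcyl⟩ := exists_isQStepBernoulli
    (ρ := ProbabilityTheory.cond μ A) (t := T + i) (j := j) (Q := Q) (by omega)
    (ProbabilityTheory.cond_absolutelyContinuous.ae_le hQ)
    (hmem.mono fun ω hω => (hret ω hω).1) (hmem.mono fun ω hω => (hret ω hω).2)
  refine ⟨ν, ⟨j, _, hB⟩, hp, hinv, ?_, fun n w => ?_⟩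
  · refine (blockEnt_mono M (by omega) _).trans (hent.trans ?_)
    have : ((T + i : ℕ) : ℝ) ≤ T + L := by exact_mod_cast Nat.add_le_add_left hi T
    exact mul_le_mul_of_nonneg_right this (entS_nonneg hinv)
  · have e : ∑ k ∈ Finset.range T, (T : ℝ)⁻¹ * μ.real (A ∩ (shiftMap M)^[k] ⁻¹' cylW M w) =
        μ.real A * ∑ k ∈ Finset.range T, (T : ℝ)⁻¹ *
          (ProbabilityTheory.cond μ A).real ((shiftMap M)^[k] ⁻¹' cylW M w) := by
      rw [Finset.mul_sum]
      refine Finset.sum_congr rfl fun k _ => ?_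
      rw [← real_mul_cond μ hA]
      ring
    rw [e, ← mul_sub, abs_mul, abs_of_nonneg measureReal_nonneg]
    refine mul_le_mul_of_nonneg_left ?_ measureReal_nonneg
    have h1 := hcyl n w
    have h2 := abs_average_sub_average_le hT (Nat.le_add_right T i)
      (Nat.add_le_add_left hi T)
      (fun k => (ProbabilityTheory.cond μ A).real ((shiftMap M)^[k] ⁻¹' cylW M w))
      (fun _ => measureReal_nonneg) (fun _ => measureReal_le_one)
    have hT0 : (0 : ℝ) < T := by exact_mod_cast hT
    have h3 : (n : ℝ) / (T + i : ℕ) ≤ n / T := by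
      gcongr
      exact Nat.le_add_right T i
    refine (abs_sub_le _ _ _).trans ((add_le_add (h1.trans h3) h2).trans (le_of_eq ?_))
    ring

/-- Decomposition of most of the space into finitely many pieces, each of which is modelled by a
`q`-step Bernoulli measure. -/
lemma exists_bernoulli_partition (h : MeasurePreserving (shiftMap M) μ μ)
    (hQ : ∀ᵐ ω ∂μ, ω ∈ SigmaQ M Q) {ε : ℝ} (hε : 0 < ε) (m : ℕ) :
    ∃ T₀ : ℕ, ∀ T ≥ T₀, ∃ (ι : Type) (_ : Fintype ι) (A : ι → Set (ℕ → Fin M))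
      (ν : ι → Measure (ℕ → Fin M)),
      (∀ b, MeasurableSet (A b)) ∧ (Pairwise fun b c => Disjoint (A b) (A c)) ∧
      1 - ε ≤ ∑ b, μ.real (A b) ∧
      (∀ b, ∃ j q, IsQStepBernoulli M Q (ν b) j q) ∧ (∀ b, IsProbabilityMeasure (ν b)) ∧
      (∀ b, MeasurePreserving (shiftMap M) (ν b) (ν b)) ∧
      (∀ b, ∀ n ≤ m, ∀ w : Fin n → Fin M, |μ.real (A b) * (ν b).real (cylW M w) -
        ∑ k ∈ Finset.range T, (T : ℝ)⁻¹ * μ.real (A b ∩ (shiftMap M)^[k] ⁻¹' cylW M w)| ≤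
          μ.real (A b) * ε) ∧
      entS M μ - ε ≤ ∑ b, μ.real (A b) * entS M (ν b) := by
  have hlog : 0 ≤ Real.log M := Real.log_natCast_nonneg M
  set ε' := min ε (ε / (2 * (Real.log M + 1))) with hε'
  have hε'0 : 0 < ε' := lt_min hε (by positivity)
  have hε'1 : ε' * Real.log M ≤ ε / 2 := by
    calc ε' * Real.log M ≤ ε / (2 * (Real.log M + 1)) * (Real.log M + 1) :=
          mul_le_mul (min_le_right _ _) (by linarith) hlog (by positivity)
      _ = ε / 2 := by field_simp
  obtain ⟨L, hL⟩ := exists_return h hε'0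
  let κ := Fin M × Fin (L + 1)
  set K : ℝ := L * Real.log M + Real.log (Fintype.card (Option κ)) with hK
  have ev : ∀ᶠ T : ℕ in atTop, 0 < T ∧ (m + L : ℝ) / T ≤ ε ∧ K / T ≤ ε / 2 := by
    refine (eventually_gt_atTop 0).and (Filter.Eventually.and ?_ ?_)
    · exact (tendsto_const_div_atTop_nhds_zero_nat _).eventually_le_const hε
    · exact (tendsto_const_div_atTop_nhds_zero_nat _).eventually_le_const (half_pos hε)
  obtain ⟨T₀, hT₀⟩ := eventually_atTop.1 ev
  refine ⟨T₀, fun T hTT => ?_⟩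
  obtain ⟨hT, hT1, hT2⟩ := hT₀ T hTT
  have hT0 : (0 : ℝ) < T := by exact_mod_cast hT
  obtain ⟨C, hCm, hCs, hCn⟩ := exists_return_code M T L
  let _ : MeasurableSpace (Option κ) := ⊤
  have : MeasurableSingletonClass (Option κ) := ⟨fun _ => trivial⟩
  have hC : Measurable C := measurable_to_countable' hCm
  have hsum := sum_real_preimage μ hC
  rw [Fintype.sum_option] at hsum
  have hnone : μ.real (C ⁻¹' {none}) ≤ ε' :=
    (measureReal_mono (fun ω hω => hCn ω hω)).trans (hL T)
  classical
  let ι := {c : κ // μ (C ⁻¹' {some c}) ≠ 0}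
  have hex := fun b : ι => exists_isQStepBernoulli_of_return (L := L) (i := b.1.2) (j := b.1.1)
    (T := T) hQ (hCm (some b.1)) b.2 hT (by omega) (fun ω hω => hCs ω _ _ hω)
  choose ν hB hp hinv hent hcyl using hex
  have hres : ∀ F : κ → ℝ, ∑ c, μ.real (C ⁻¹' {some c}) * F c =
      ∑ b : ι, μ.real (C ⁻¹' {some b.1}) * F b.1 := fun F => by
    rw [← Finset.sum_subtype (Finset.univ.filter fun c : κ => μ (C ⁻¹' {some c}) ≠ 0) (by simp)
      fun c => μ.real (C ⁻¹' {some c}) * F c]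
    refine (Finset.sum_filter_of_ne fun c _ (hc : _ ≠ (0 : ℝ)) => ?_).symm
    intro h0
    apply hc
    rw [measureReal_def, h0, ENNReal.toReal_zero, zero_mul]
  have hmass : ∑ b : ι, μ.real (C ⁻¹' {some b.1}) = 1 - μ.real (C ⁻¹' {none}) := by
    have := hres fun _ => 1
    simp only [mul_one] at this
    rw [← this]
    linarith
  refine ⟨ι, inferInstance, fun b => C ⁻¹' {some b.1}, ν, fun b => hCm _, fun b c hbc => ?_, ?_,
    hB, hp, hinv, fun b n hn w => (hcyl b n w).trans ?_, ?_⟩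
  · refine Disjoint.preimage _ (Set.disjoint_singleton.2 fun h => hbc ?_)
    exact Subtype.ext (Option.some.inj h)
  · have := hnone.trans (min_le_left _ _)
    linarith
  · refine mul_le_mul_of_nonneg_left (le_trans ?_ hT1) measureReal_nonneg
    gcongr
  · have hνlog : ∑ b : ι, μ.real (C ⁻¹' {some b.1}) * entS M (ν b) ≤ Real.log M := by
      calc _ ≤ ∑ b : ι, μ.real (C ⁻¹' {some b.1}) * Real.log M := Finset.sum_le_sum fun b _ =>
            mul_le_mul_of_nonneg_left (by have := hp b; exact entS_le_log (hinv b))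
              measureReal_nonneg
        _ ≤ 1 * Real.log M := by
            rw [← Finset.sum_mul, hmass]
            exact mul_le_mul_of_nonneg_right (sub_le_self _ measureReal_nonneg) hlog
        _ = _ := one_mul _
    set s := ∑ b : ι, μ.real (C ⁻¹' {some b.1}) * entS M (ν b) with hs
    have h1 : T * entS M μ ≤ blockEnt M T μ := by
      have := entS_le_div h hT.ne'
      rwa [le_div_iff₀ hT0, mul_comm] at this
    have h2 := entOf_le_sum_cond μ (measurable_coords M T) hC
    rw [Fintype.sum_option, hres fun c => entOf (ProbabilityTheory.cond μ (C ⁻¹' {some c}))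
      (fun (ω : ℕ → Fin M) (i : Fin T) => ω i)] at h2
    have h3 := entOf_le_log_card μ hC
    have h4 : μ.real (C ⁻¹' {none}) * entOf (ProbabilityTheory.cond μ (C ⁻¹' {none}))
        (fun (ω : ℕ → Fin M) (i : Fin T) => ω i) ≤ T * (ε' * Real.log M) := by
      by_cases h0 : μ (C ⁻¹' {none}) = 0
      · rw [measureReal_def, h0, ENNReal.toReal_zero, zero_mul]
        positivity
      · have := ProbabilityTheory.cond_isProbabilityMeasure h0
        calc _ ≤ ε' * (T * Real.log M) := mul_le_mul hnone
              (blockEnt_le_mul_log T _) (entOf_nonneg _ _) hε'0.le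
          _ = _ := by ring
    have h5 : ∑ b : ι, μ.real (C ⁻¹' {some b.1}) *
        entOf (ProbabilityTheory.cond μ (C ⁻¹' {some b.1}))
          (fun (ω : ℕ → Fin M) (i : Fin T) => ω i) ≤ (T + L) * s := by
      rw [hs, Finset.mul_sum]
      refine Finset.sum_le_sum fun b _ => ?_
      rw [mul_left_comm]
      exact mul_le_mul_of_nonneg_left (hent b) measureReal_nonneg
    have h6 : (L : ℝ) * s ≤ L * Real.log M := mul_le_mul_of_nonneg_left hνlog (Nat.cast_nonneg L)
    have h7 : K ≤ ε / 2 * T := (div_le_iff₀ hT0).1 hT2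
    have h8 : T * (ε' * Real.log M) ≤ T * (ε / 2) := mul_le_mul_of_nonneg_left hε'1 hT0.le
    have h9 : T * entS M μ ≤ T * (s + ε) := by
      unfold blockEnt at h1
      linarith
    linarith [le_of_mul_le_mul_left h9 hT0]

end

lemma norm_sum_indicatorConstLp_le_one {Ω : Type*} [MeasurableSpace Ω] {μ : Measure Ω}
    [IsProbabilityMeasure μ] {ι : Type*} [Fintype ι] {A : ι → Set Ω}
    (hA : ∀ b, MeasurableSet (A b)) (hd : Pairwise fun b c => Disjoint (A b) (A c)) (s : ι → ℝ)
    (hs : ∀ b, |s b| ≤ 1) :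
    ‖∑ b, indicatorConstLp 2 (hA b) (measure_ne_top μ _) (s b)‖ ≤ 1 := by
  rw [← sq_le_one_iff₀ (norm_nonneg _), ← real_inner_self_eq_norm_sq, inner_sum]
  calc ∑ b, inner ℝ (∑ c, indicatorConstLp 2 (hA c) (measure_ne_top μ _) (s c))
        (indicatorConstLp 2 (hA b) (measure_ne_top μ _) (s b))
      = ∑ b, μ.real (A b) * s b ^ 2 := by
        refine Finset.sum_congr rfl fun b _ => ?_
        rw [sum_inner, Finset.sum_eq_single b]
        · rw [L2.inner_indicatorConstLp_indicatorConstLp, Set.inter_self,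
            real_inner_self_eq_norm_sq, Real.norm_eq_abs, sq_abs, smul_eq_mul]
        · intro c _ hcb
          rw [L2.inner_indicatorConstLp_indicatorConstLp, (hd hcb).inter_eq, measureReal_empty,
            zero_smul]
        · simp
    _ ≤ ∑ b, μ.real (A b) := Finset.sum_le_sum fun b _ =>
        mul_le_of_le_one_right measureReal_nonneg ((sq_le_one_iff_abs_le_one _).2 (hs b))
    _ = μ.real (⋃ b, A b) := (measureReal_iUnion_fintype hd hA).symm
    _ ≤ 1 := measureReal_le_one

/-- The mean ergodic theorem for the indicator of a set under an ergodic map. -/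
lemma Ergodic.tendsto_birkhoffAverage_indicatorConstLp {Ω : Type*} [MeasurableSpace Ω]
    {μ : Measure Ω} [IsProbabilityMeasure μ] {f : Ω → Ω} (hf : Ergodic f μ) {S : Set Ω}
    (hS : MeasurableSet S) :
    Tendsto (fun n => birkhoffAverage ℝ
      (Lp.compMeasurePreserving f hf.toMeasurePreserving) id n
        (indicatorConstLp 2 hS (measure_ne_top μ _) (1 : ℝ))) atTop
      (nhds (indicatorConstLp 2 MeasurableSet.univ (measure_ne_top μ _) (μ.real S))) := by
  let U : Lp ℝ 2 μ →L[ℝ] Lp ℝ 2 μ :=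
    (Lp.compMeasurePreservingₗᵢ ℝ f hf.toMeasurePreserving).toContinuousLinearMap
  set x : Lp ℝ 2 μ := indicatorConstLp 2 hS (measure_ne_top μ _) (1 : ℝ)
  have hU := U.tendsto_birkhoffAverage_orthogonalProjection
    (LinearIsometry.norm_toContinuousLinearMap_le _) x
  set V := U.eqLocus (1 : Lp ℝ 2 μ →L[ℝ] Lp ℝ 2 μ)
  set P : Lp ℝ 2 μ := (V.orthogonalProjectionOnto x).1
  suffices hPS : P = indicatorConstLp 2 MeasurableSet.univ (measure_ne_top μ _) (μ.real S) by
    rw [← hPS]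
    exact hU
  have hPf : Lp.compMeasurePreserving f hf.toMeasurePreserving P = P :=
    (V.orthogonalProjectionOnto x).2
  have hae : P ∘ f =ᵐ[μ] P := by
    have := Lp.coeFn_compMeasurePreserving P hf.toMeasurePreserving
    rw [hPf] at this
    exact this.symm
  obtain ⟨c, hc⟩ := hf.ae_eq_const_of_ae_eq_comp_ae (Lp.aestronglyMeasurable P) hae
  have hPc : P = indicatorConstLp 2 MeasurableSet.univ (measure_ne_top μ _) c := by
    refine Lp.ext (hc.trans ?_)
    rw [indicatorConstLp_univ]
    exact (Lp.coeFn_const 2 μ c).symm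
  set e : Lp ℝ 2 μ := indicatorConstLp 2 MeasurableSet.univ (measure_ne_top μ _) 1 with he
  have heV : e ∈ V := by
    change Lp.compMeasurePreserving f hf.toMeasurePreserving e = e
    exact (Lp.indicatorConstLp_compMeasurePreserving MeasurableSet.univ (measure_ne_top μ _) 1
      hf.toMeasurePreserving).symm
  have h0 : inner ℝ (x - P) e = 0 := V.starProjection_inner_eq_zero x e heV
  rw [inner_sub_left, hPc, L2.inner_indicatorConstLp_indicatorConstLp,
    L2.inner_indicatorConstLp_indicatorConstLp] at h0
  simp at h0
  rw [hPc]
  congr 1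
  linarith

lemma Ergodic.exists_sum_abs_average_sub_le {Ω : Type*} [MeasurableSpace Ω]
    {μ : Measure Ω} [IsProbabilityMeasure μ] {f : Ω → Ω} (hf : Ergodic f μ) {S : Set Ω}
    (hS : MeasurableSet S) {ε : ℝ} (hε : 0 < ε) :
    ∃ T₀ : ℕ, ∀ T ≥ T₀, ∀ (ι : Type) (_ : Fintype ι) (A : ι → Set Ω),
      (∀ b, MeasurableSet (A b)) → (Pairwise fun b c => Disjoint (A b) (A c)) →
      ∑ b, |∑ k ∈ Finset.range T, (T : ℝ)⁻¹ * μ.real (A b ∩ f^[k] ⁻¹' S) -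
        μ.real (A b) * μ.real S| ≤ ε := by
  have hlim := hf.tendsto_birkhoffAverage_indicatorConstLp hS
  obtain ⟨T₀, hT₀⟩ := Metric.tendsto_atTop.1 hlim ε hε
  refine ⟨T₀, fun T hT ι _ A hA hd => ?_⟩
  have hT := hT₀ T hT
  rw [dist_eq_norm] at hT
  set y := birkhoffAverage ℝ (Lp.compMeasurePreserving f hf.toMeasurePreserving) id T
        (indicatorConstLp 2 hS (measure_ne_top μ _) (1 : ℝ)) with hy
  set z : Lp ℝ 2 μ := indicatorConstLp 2 MeasurableSet.univ (measure_ne_top μ _) (μ.real S)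
  have hyk : y = ∑ k ∈ Finset.range T, (T : ℝ)⁻¹ •
      indicatorConstLp 2 ((hf.measurable.iterate k) hS) (measure_ne_top μ _) (1 : ℝ) := by
    rw [hy, birkhoffAverage, birkhoffSum, Finset.smul_sum]
    refine Finset.sum_congr rfl fun k _ => ?_
    rw [Lp.compMeasurePreserving_iterate, id, Lp.indicatorConstLp_compMeasurePreserving]
  let a : ι → ℝ := fun b => ∑ k ∈ Finset.range T, (T : ℝ)⁻¹ * μ.real (A b ∩ f^[k] ⁻¹' S) -
        μ.real (A b) * μ.real S
  let s : ι → ℝ := fun b => SignType.sign (a b)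
  have hs : ∀ b, |s b| ≤ 1 := fun b => by
    rcases lt_trichotomy (a b) 0 with h | h | h <;> simp [s, h]
  have hin : ∀ b, inner ℝ (indicatorConstLp 2 (hA b) (measure_ne_top μ _) (s b)) (y - z) =
      |a b| := fun b => by
    rw [inner_sub_right, hyk, inner_sum, L2.inner_indicatorConstLp_indicatorConstLp]
    simp only [inner_smul_right, L2.inner_indicatorConstLp_indicatorConstLp]
    have habs : |a b| = s b * a b := (sign_mul_self (a b)).symm
    rw [habs, mul_sub, Finset.mul_sum, Set.inter_univ]
    congr 1
    · refine Finset.sum_congr rfl fun k _ => ?_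
      simp
      ring
    · simp
      ring
  calc ∑ b, |a b| = inner ℝ (∑ b, indicatorConstLp 2 (hA b) (measure_ne_top μ _) (s b))
        (y - z) := by rw [sum_inner]; simp only [hin]
    _ ≤ 1 * ‖y - z‖ := (real_inner_le_norm _ _).trans
        (mul_le_mul_of_nonneg_right (norm_sum_indicatorConstLp_le_one hA hd s hs) (norm_nonneg _))
    _ ≤ ε := by rw [one_mul]; exact hT.le

section

/-- The total discrepancy between two measures on the cylinders of length `n`. -/
def cylDist (M n : ℕ) (ν μ : Measure (ℕ → Fin M)) : ℝ :=
  ∑ w : Fin n → Fin M, |ν.real (cylW M w) - μ.real (cylW M w)|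

lemma cylDist_nonneg {M : ℕ} (n : ℕ) (ν μ : Measure (ℕ → Fin M)) : 0 ≤ cylDist M n ν μ :=
  Finset.sum_nonneg fun _ _ => abs_nonneg _

lemma abs_sub_le_cylDist {M n : ℕ} (ν μ : Measure (ℕ → Fin M)) (w : Fin n → Fin M) :
    |ν.real (cylW M w) - μ.real (cylW M w)| ≤ cylDist M n ν μ :=
  Finset.single_le_sum (f := fun w : Fin n → Fin M => |ν.real (cylW M w) - μ.real (cylW M w)|)
    (fun _ _ => abs_nonneg _) (Finset.mem_univ w)

lemma sum_mul_cylDist_le {M : ℕ} {μ : Measure (ℕ → Fin M)} {n T : ℕ} {ι : Type}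
    [Fintype ι] {A : ι → Set (ℕ → Fin M)} {ν : ι → Measure (ℕ → Fin M)}
    (hP : ∑ b, μ.real (A b) ≤ 1) {ε : ℝ} (hε : 0 ≤ ε)
    (h1 : ∀ b, ∀ w : Fin n → Fin M, |μ.real (A b) * (ν b).real (cylW M w) -
      ∑ k ∈ Finset.range T, (T : ℝ)⁻¹ * μ.real (A b ∩ (shiftMap M)^[k] ⁻¹' cylW M w)| ≤
        μ.real (A b) * ε)
    (h2 : ∀ w : Fin n → Fin M,
      ∑ b, |∑ k ∈ Finset.range T, (T : ℝ)⁻¹ * μ.real (A b ∩ (shiftMap M)^[k] ⁻¹' cylW M w) -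
        μ.real (A b) * μ.real (cylW M w)| ≤ ε) :
    ∑ b, μ.real (A b) * cylDist M n (ν b) μ ≤ M ^ n * (2 * ε) := by
  calc ∑ b, μ.real (A b) * cylDist M n (ν b) μ
      = ∑ w : Fin n → Fin M, ∑ b, |μ.real (A b) * (ν b).real (cylW M w) -
          μ.real (A b) * μ.real (cylW M w)| := by
        rw [Finset.sum_comm]
        refine Finset.sum_congr rfl fun b _ => ?_
        rw [cylDist, Finset.mul_sum]
        refine Finset.sum_congr rfl fun w _ => ?_
        rw [← mul_sub, abs_mul, abs_of_nonneg measureReal_nonneg]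
    _ ≤ ∑ w : Fin n → Fin M, 2 * ε := by
        refine Finset.sum_le_sum fun w _ => ?_
        refine (Finset.sum_le_sum fun b _ => (abs_sub_le _ _ _).trans
          (add_le_add_left (h1 b w) _)).trans ?_
        rw [Finset.sum_add_distrib, ← Finset.sum_mul]
        have := mul_le_of_le_one_left hε hP
        linarith [h2 w]
    _ = M ^ n * (2 * ε) := by simp

variable {M : ℕ} {Q : Fin M → Fin M → Bool} {μ : Measure (ℕ → Fin M)} [IsProbabilityMeasure μ]

lemma exists_forall_cylinder_average (hμ : Ergodic (shiftMap M) μ) (n : ℕ) {ε : ℝ}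
    (hε : 0 < ε) :
    ∃ T₀ : ℕ, ∀ T ≥ T₀, ∀ (ι : Type) (_ : Fintype ι) (A : ι → Set (ℕ → Fin M)),
      (∀ b, MeasurableSet (A b)) → (Pairwise fun b c => Disjoint (A b) (A c)) →
      ∀ w : Fin n → Fin M,
      ∑ b, |∑ k ∈ Finset.range T, (T : ℝ)⁻¹ * μ.real (A b ∩ (shiftMap M)^[k] ⁻¹' cylW M w) -
        μ.real (A b) * μ.real (cylW M w)| ≤ ε := by
  choose T₀ hT₀ using fun w : Fin n → Fin M =>
    hμ.exists_sum_abs_average_sub_le (measurableSet_cylW M w) hε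
  exact ⟨Finset.univ.sup T₀, fun T hT ι _ A hA hd w =>
    hT₀ w T ((Finset.le_sup (Finset.mem_univ w)).trans hT) ι _ A hA hd⟩

lemma sum_real_le_one_of_disjoint {ι : Type*} [Fintype ι] {A : ι → Set (ℕ → Fin M)}
    (hA : ∀ b, MeasurableSet (A b)) (hd : Pairwise fun b c => Disjoint (A b) (A c)) :
    ∑ b, μ.real (A b) ≤ 1 :=
  (measureReal_iUnion_fintype hd hA).symm.le.trans measureReal_le_one

/-- Approximation of an ergodic measure by a single `q`-step Bernoulli measure. -/
theorem Ergodic.exists_isQStepBernoulli_near (hμ : Ergodic (shiftMap M) μ)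
    (hQ : ∀ᵐ ω ∂μ, ω ∈ SigmaQ M Q) {ε : ℝ} (hε : 0 < ε) (m : ℕ) :
    ∃ ν : Measure (ℕ → Fin M), (∃ j q, IsQStepBernoulli M Q ν j q) ∧
      (∀ w : Fin m → Fin M, |ν.real (cylW M w) - μ.real (cylW M w)| < ε) ∧
      |entS M ν - entS M μ| < ε := by
  have hinv := hμ.toMeasurePreserving
  have hlog : 0 ≤ Real.log M := Real.log_natCast_nonneg M
  obtain ⟨n, δ₀, hδ₀, husc⟩ := exists_entS_lt hinv hε
  set δ := min δ₀ ε
  have hδ : 0 < δ := lt_min hδ₀ hε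
  set N : ℝ := 2 * M ^ m + 2 * M ^ n
  set D : ℝ := 1 + ε + (Real.log M + ε) / δ * N
  have hD : 0 < D := by positivity
  set ε' := ε / (2 * D)
  have hε' : 0 < ε' := by positivity
  obtain ⟨T₁, hT₁⟩ := exists_bernoulli_partition hinv hQ hε' (max m n)
  obtain ⟨T₂, hT₂⟩ := exists_forall_cylinder_average hμ m hε'
  obtain ⟨T₃, hT₃⟩ := exists_forall_cylinder_average hμ n hε'
  set T := max T₁ (max T₂ T₃)
  obtain ⟨ι, _, A, ν, hA, hd, hmass, hB, hp, hν, hcyl, hent⟩ := hT₁ T (le_max_left _ _)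
  have hP := sum_real_le_one_of_disjoint (μ := μ) hA hd
  have hm := sum_mul_cylDist_le hP hε'.le (fun b => hcyl b m (le_max_left _ _))
    (hT₂ T ((le_max_left _ _).trans (le_max_right _ _)) ι _ A hA hd)
  have hn := sum_mul_cylDist_le hP hε'.le (fun b => hcyl b n (le_max_right _ _))
    (hT₃ T ((le_max_right _ _).trans (le_max_right _ _)) ι _ A hA hd)
  let d : ι → ℝ := fun b => cylDist M m (ν b) μ + cylDist M n (ν b) μ
  have hd0 : ∀ b, 0 ≤ d b := fun b => add_nonneg (cylDist_nonneg _ _ _) (cylDist_nonneg _ _ _)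
  have hdsum : ∑ b, μ.real (A b) * d b ≤ N * ε' := by
    simp only [d, mul_add, Finset.sum_add_distrib]
    linarith
  by_contra hcon
  have hbound : ∀ b, entS M (ν b) ≤ (entS M μ - ε) + (Real.log M + ε) / δ * d b := fun b => by
    have := hp b
    by_cases hb : d b < δ
    · have h1 : ∀ w : Fin m → Fin M, |(ν b).real (cylW M w) - μ.real (cylW M w)| < ε :=
        fun w => by
          have := abs_sub_le_cylDist (ν b) μ w
          have := cylDist_nonneg n (ν b) μ
          have : δ ≤ ε := min_le_right _ _
          grind
      have h2 : entS M (ν b) < entS M μ + ε := husc _ (hp b) (hν b) fun w => by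
          have := abs_sub_le_cylDist (ν b) μ w
          have := cylDist_nonneg m (ν b) μ
          have : δ ≤ δ₀ := min_le_left _ _
          grind
      have h3 : entS M (ν b) ≤ entS M μ - ε := by
        by_contra! h3
        exact hcon ⟨ν b, hB b, h1, abs_lt.2 ⟨by linarith, by linarith⟩⟩
      have : 0 ≤ (Real.log M + ε) / δ * d b := mul_nonneg (by positivity) (hd0 b)
      linarith
    · have h1 : Real.log M + ε ≤ (Real.log M + ε) / δ * d b := by
        rw [div_mul_eq_mul_div, le_div_iff₀ hδ]
        exact mul_le_mul_of_nonneg_left (not_lt.1 hb) (by linarith)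
      linarith [entS_le_log (hν b), entS_nonneg hinv]
  have h1 : ∑ b, μ.real (A b) * entS M (ν b) ≤
      (∑ b, μ.real (A b)) * (entS M μ - ε) + (Real.log M + ε) / δ * (N * ε') := by
    calc _ ≤ ∑ b, μ.real (A b) * ((entS M μ - ε) + (Real.log M + ε) / δ * d b) :=
          Finset.sum_le_sum fun b _ => mul_le_mul_of_nonneg_left (hbound b) measureReal_nonneg
      _ = (∑ b, μ.real (A b)) * (entS M μ - ε) +
          (Real.log M + ε) / δ * ∑ b, μ.real (A b) * d b := by
        rw [Finset.sum_mul, Finset.mul_sum, ← Finset.sum_add_distrib]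
        exact Finset.sum_congr rfl fun b _ => by ring
      _ ≤ _ := by gcongr
  have h2 : (∑ b, μ.real (A b)) * entS M μ ≤ entS M μ :=
    mul_le_of_le_one_left (entS_nonneg hinv) hP
  have h3 : (1 - ε') * ε ≤ (∑ b, μ.real (A b)) * ε := mul_le_mul_of_nonneg_right hmass hε.le
  have h4 : ε' * D = ε / 2 := by simp only [ε']; field_simp
  have h5 : ε' * D = ε' + ε' * ε + (Real.log M + ε) / δ * (N * ε') := by simp only [D]; ring
  linarith

section Mixture

variable {ι : Type*} [Fintype ι]

lemma mixture_real_apply {Ω : Type*} [MeasurableSpace Ω] {c : ι → ℝ≥0∞} (hc : ∀ b, c b ≠ ∞)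
    (ν : ι → Measure Ω) [∀ b, IsFiniteMeasure (ν b)] (S : Set Ω) :
    (∑ b, c b • ν b).real S = ∑ b, (c b).toReal * (ν b).real S := by
  simp only [measureReal_def, Measure.coe_finsetSum, Finset.sum_apply, Measure.smul_apply,
    smul_eq_mul]
  rw [ENNReal.toReal_sum fun b _ => ENNReal.mul_ne_top (hc b) (measure_ne_top _ _)]
  simp only [ENNReal.toReal_mul]

lemma isProbabilityMeasure_mixture {Ω : Type*} [MeasurableSpace Ω] {c : ι → ℝ≥0∞}
    (hc : ∑ b, c b = 1) (ν : ι → Measure Ω) [∀ b, IsProbabilityMeasure (ν b)] :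
    IsProbabilityMeasure (∑ b, c b • ν b) := ⟨by simp [hc]⟩

lemma measurePreserving_mixture {Ω : Type*} [MeasurableSpace Ω] {f : Ω → Ω} (hf : Measurable f)
    (c : ι → ℝ≥0∞) {ν : ι → Measure Ω} (hν : ∀ b, MeasurePreserving f (ν b) (ν b)) :
    MeasurePreserving f (∑ b, c b • ν b) (∑ b, c b • ν b) := by
  refine ⟨hf, Measure.ext fun S hS => ?_⟩
  rw [Measure.map_apply hf hS]
  simp only [Measure.coe_finsetSum, Finset.sum_apply, Measure.smul_apply,
    (hν _).measure_preimage hS.nullMeasurableSet]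

end Mixture

lemma abs_sum_average_sub_le (h : MeasurePreserving (shiftMap M) μ μ) {ι : Type*} [Fintype ι]
    {A : ι → Set (ℕ → Fin M)} (hA : ∀ b, MeasurableSet (A b))
    (hd : Pairwise fun b c => Disjoint (A b) (A c)) {ε : ℝ} (hmass : 1 - ε ≤ ∑ b, μ.real (A b))
    {T : ℕ} (hT : T ≠ 0) {S : Set (ℕ → Fin M)} (hS : MeasurableSet S) :
    |∑ b, ∑ k ∈ Finset.range T, (T : ℝ)⁻¹ * μ.real (A b ∩ (shiftMap M)^[k] ⁻¹' S) -
      μ.real S| ≤ ε := by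
  have hk : ∀ k, |∑ b, μ.real (A b ∩ (shiftMap M)^[k] ⁻¹' S) - μ.real S| ≤ ε := fun k => by
    have hSk : MeasurableSet ((shiftMap M)^[k] ⁻¹' S) := (measurable_shiftMap M).iterate k hS
    rw [← (h.iterate k).measureReal_preimage hS.nullMeasurableSet]
    rw [← measureReal_iUnion_fintype
      (fun b c hbc => (hd hbc).mono Set.inter_subset_left Set.inter_subset_left)
      (fun b => (hA b).inter hSk), ← Set.iUnion_inter]
    have h1 := measureReal_iUnion_fintype (μ := μ) hd hA
    have hU : MeasurableSet (⋃ b, A b) := MeasurableSet.iUnion hA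
    have h2 := measureReal_inter_add_sdiff (μ := μ) (s := (shiftMap M)^[k] ⁻¹' S) hU
    have h3 : μ.real ((shiftMap M)^[k] ⁻¹' S \ ⋃ b, A b) ≤ μ.real (⋃ b, A b)ᶜ :=
      measureReal_mono fun _ hx => hx.2
    have h4 := probReal_compl_eq_one_sub (μ := μ) hU
    rw [Set.inter_comm, abs_le]
    have h5 : 0 ≤ μ.real ((shiftMap M)^[k] ⁻¹' S \ ⋃ b, A b) := measureReal_nonneg
    constructor <;> linarith
  have hT0 : (0 : ℝ) < T := by exact_mod_cast Nat.pos_of_ne_zero hT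
  have e : ∑ b, ∑ k ∈ Finset.range T, (T : ℝ)⁻¹ * μ.real (A b ∩ (shiftMap M)^[k] ⁻¹' S) -
      μ.real S = ∑ k ∈ Finset.range T, (T : ℝ)⁻¹ *
        (∑ b, μ.real (A b ∩ (shiftMap M)^[k] ⁻¹' S) - μ.real S) := by
    rw [Finset.sum_comm, ← Finset.mul_sum, Finset.sum_sub_distrib, mul_sub]
    simp only [← Finset.mul_sum, Finset.sum_const, Finset.card_range, nsmul_eq_mul]
    field_simp
  rw [e]
  refine (Finset.abs_sum_le_sum_abs _ _).trans ?_
  calc _ ≤ ∑ k ∈ Finset.range T, (T : ℝ)⁻¹ * ε := Finset.sum_le_sum fun k _ => by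
        rw [abs_mul, abs_of_pos (inv_pos.2 hT0)]
        exact mul_le_mul_of_nonneg_left (hk k) (inv_pos.2 hT0).le
    _ = ε := by
      simp only [Finset.sum_const, Finset.card_range, nsmul_eq_mul]
      field_simp

/-- Approximation of an invariant measure by a convex combination of `q`-step Bernoulli measures. -/
theorem exists_mixture_isQStepBernoulli_near (h : MeasurePreserving (shiftMap M) μ μ)
    (hQ : ∀ᵐ ω ∂μ, ω ∈ SigmaQ M Q) {ε : ℝ} (hε : 0 < ε) (m : ℕ) :
    ∃ (ι : Type) (_ : Fintype ι) (c : ι → ℝ≥0∞) (ν : ι → Measure (ℕ → Fin M)),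
      (∀ b, ∃ j q, IsQStepBernoulli M Q (ν b) j q) ∧ (∑ b, c b) = 1 ∧
      (∀ w : Fin m → Fin M, |(∑ b, c b • ν b).real (cylW M w) - μ.real (cylW M w)| < ε) ∧
      |entS M (∑ b, c b • ν b) - entS M μ| < ε := by
  classical
  obtain ⟨n, δ₀, hδ₀, husc⟩ := exists_entS_lt h hε
  set ε' := min (1 / 2) (min (ε / 4) (δ₀ / 4)) with hε'
  have hε'0 : 0 < ε' := by positivity
  have hε'1 : ε' ≤ 1 / 2 := min_le_left _ _
  have hε'2 : ε' ≤ ε / 4 := (min_le_right _ _).trans (min_le_left _ _)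
  have hε'3 : ε' ≤ δ₀ / 4 := (min_le_right _ _).trans (min_le_right _ _)
  obtain ⟨T₀, hT₀⟩ := exists_bernoulli_partition h hQ hε'0 (max m n)
  obtain ⟨ι, _, A, ν, hA, hd, hmass, hB, hp, hν, hcyl, hent⟩ := hT₀ (T₀ + 1) (Nat.le_succ _)
  have hP := sum_real_le_one_of_disjoint (μ := μ) hA hd
  obtain ⟨b₀⟩ : Nonempty ι := by
    by_contra hne
    rw [not_nonempty_iff] at hne
    simp at hmass
    linarith
  set r := 1 - ∑ b, μ.real (A b) with hr
  have hr0 : 0 ≤ r := by linarith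
  have hr1 : r ≤ ε' := by linarith
  let a : ι → ℝ := fun b => μ.real (A b) + if b = b₀ then r else 0
  have ha0 : ∀ b, 0 ≤ a b := fun b => add_nonneg measureReal_nonneg (by split_ifs <;> simp [hr0])
  have hsum : ∀ F : ι → ℝ, ∑ b, a b * F b = ∑ b, μ.real (A b) * F b + r * F b₀ := fun F => by
    simp [a, add_mul, Finset.sum_add_distrib]
  have ha1 : ∑ b, a b = 1 := by
    have := hsum fun _ => 1
    simp only [mul_one] at this
    linarith
  set c : ι → ℝ≥0∞ := fun b => ENNReal.ofReal (a b) with hc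
  have hct : ∀ b, c b ≠ ∞ := fun b => ENNReal.ofReal_ne_top
  have hc1 : ∑ b, c b = 1 := by
    rw [hc, ← ENNReal.ofReal_sum_of_nonneg fun b _ => ha0 b, ha1, ENNReal.ofReal_one]
  have hreal : ∀ S, (∑ b, c b • ν b).real S = ∑ b, a b * (ν b).real S := fun S => by
    rw [mixture_real_apply hct]
    simp only [hc, ENNReal.toReal_ofReal (ha0 _)]
  have hprob := isProbabilityMeasure_mixture hc1 ν
  have hmp := measurePreserving_mixture (measurable_shiftMap M) c hν
  have hclose : ∀ k ≤ max m n, ∀ w : Fin k → Fin M,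
      |(∑ b, c b • ν b).real (cylW M w) - μ.real (cylW M w)| ≤ 3 * ε' := fun k hk w => by
    have h1 := abs_sum_average_sub_le h hA hd hmass (Nat.succ_ne_zero T₀) (measurableSet_cylW M w)
    have h2 := (Finset.abs_sum_le_sum_abs _ _).trans
      (Finset.sum_le_sum fun b (_ : b ∈ Finset.univ) => hcyl b k hk w)
    rw [← Finset.sum_mul, Finset.sum_sub_distrib] at h2
    have h3 : (∑ b, μ.real (A b)) * ε' ≤ ε' := mul_le_of_le_one_left hε'0.le hP
    have h4 : 0 ≤ r * (ν b₀).real (cylW M w) := mul_nonneg hr0 measureReal_nonneg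
    have h5 : r * (ν b₀).real (cylW M w) ≤ r := mul_le_of_le_one_right hr0 measureReal_le_one
    rw [hreal, hsum]
    rw [abs_le] at h1 h2 ⊢
    constructor <;> linarith [h1.1, h1.2, h2.1, h2.2]
  refine ⟨ι, inferInstance, c, ν, hB, hc1, fun w => ?_, abs_lt.2 ⟨?_, ?_⟩⟩
  · have := hclose m (le_max_left _ _) w
    linarith
  · have h1 := sum_mul_entS_le ha0 ha1 hp hν hmp fun S _ => hreal S
    rw [hsum] at h1
    have := hp b₀
    have h2 : 0 ≤ r * entS M (ν b₀) := mul_nonneg hr0 (entS_nonneg (hν b₀))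
    linarith
  · have := husc _ hprob hmp fun w => by
      have := hclose n (le_max_right _ _) w
      linarith
    linarith

end

/-- **Lemma (Bernoulli approximation for Markov systems).**  For an `M × M` 0–1 transition
matrix `Q`, the family `𝓑_Q` of `q`-step Bernoulli measures (over recurrent symbols `j`
and `q ≥ 1`) is dense in the set of shift-invariant ergodic probability measures on the
subshift `Σ_Q` in the entropy plus weak* topology (tested on cylinder masses of every
finite level); in particular the convex hull of `𝓑_Q` is dense in the set of all
shift-invariant probability measures on `Σ_Q` in the same topology. -/
theorem stmt10 (M : ℕ) (hM : 0 < M) (Q : Fin M → Fin M → Bool) :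
    (∀ μ : Measure (ℕ → Fin M), IsProbabilityMeasure μ → Ergodic (shiftMap M) μ →
      μ ((SigmaQ M Q)ᶜ) = 0 →
      ∀ ε : ℝ, 0 < ε → ∀ m : ℕ,
        ∃ ν : Measure (ℕ → Fin M), (∃ j q, IsQStepBernoulli M Q ν j q) ∧
          (∀ w : Fin m → Fin M, |(ν (cylW M w)).toReal - (μ (cylW M w)).toReal| < ε) ∧
          |entS M ν - entS M μ| < ε) ∧
    (∀ μ : Measure (ℕ → Fin M), IsProbabilityMeasure μ →
      MeasurePreserving (shiftMap M) μ μ → μ ((SigmaQ M Q)ᶜ) = 0 →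
      ∀ ε : ℝ, 0 < ε → ∀ m : ℕ,
        ∃ (K : ℕ) (c : Fin K → ℝ≥0∞) (νs : Fin K → Measure (ℕ → Fin M)),
          (∀ b, ∃ j q, IsQStepBernoulli M Q (νs b) j q) ∧ (∑ b, c b) = 1 ∧
          (∀ w : Fin m → Fin M,
            |((∑ b, c b • νs b) (cylW M w)).toReal - (μ (cylW M w)).toReal| < ε) ∧
          |entS M (∑ b, c b • νs b) - entS M μ| < ε) := by
  refine ⟨fun μ _ hμ hQ ε hε m => ?_, fun μ _ hμ hQ ε hε m => ?_⟩
  · exact hμ.exists_isQStepBernoulli_near hQ hε m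
  · obtain ⟨ι, _, c, ν, hB, hc, hcyl, hent⟩ :=
      exists_mixture_isQStepBernoulli_near (Q := Q) hμ hQ hε m
    let e := (Fintype.equivFin ι).symm
    have hsum : ∑ b, c (e b) • ν (e b) = ∑ b, c b • ν b := e.sum_comp fun b => c b • ν b
    refine ⟨Fintype.card ι, fun b => c (e b), fun b => ν (e b), fun b => hB _,
      (e.sum_comp c).trans hc, ?_⟩
    rw [hsum]
    exact ⟨hcyl, hent⟩
end
end

section
/- Let d ≥ 2 and let g_i : [0,1] → ℝ be functions for i = 1, …, d such that dim_H {(x, y) ∈ [0,1] × ℝ : g_i(x) = y} ≥ 2 − δ_i for each i. Then dim_H {(x_1, …, x_d, y) ∈ [0,1]^d × ℝ : Σ_{i=1}^d g_i(x_i) = y} ≥ d + 1 − min_i δ_i. -/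
open Set Filter MeasureTheory

open scoped ENNReal NNReal Topology

noncomputable section

/-- If a set is null for the Hausdorff measure of dimension `t + card ι`, then almost every fibre
of the set under a nonexpanding map to `ι → ℝ` is null for the Hausdorff measure of
dimension `t`. The set is not assumed to be measurable. -/
theorem ae_hausdorffMeasure_inter_preimage_eq_zero {X ι : Type*} [Fintype ι] [EMetricSpace X]
    [MeasurableSpace X] [BorelSpace X] {f : X → ι → ℝ} (hf : LipschitzWith 1 f) {E : Set X}
    {t : ℝ} (ht : 0 < t) (hE : μH[t + Fintype.card ι] E = 0) :
    ∀ᵐ y : ι → ℝ, μH[t] (E ∩ f ⁻¹' {y}) = 0 := by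
  have hcover : ∀ n : ℕ, ∃ A : ℕ → Set X, E ⊆ ⋃ k, A k ∧
      (∀ k, Metric.ediam (A k) ≤ (n : ℝ≥0∞)⁻¹) ∧
      ∑' k, Metric.ediam (A k) ^ (t + Fintype.card ι) ≤ (n : ℝ≥0∞)⁻¹ := by
    intro n
    have hn : (0 : ℝ≥0∞) < (n : ℝ≥0∞)⁻¹ := by simp
    rw [Measure.hausdorffMeasure_apply] at hE
    simp only [ENNReal.iSup_eq_zero] at hE
    have h := (hE _ hn).trans_lt hn
    simp only [iInf_lt_iff] at h
    obtain ⟨A, hA, hd, hs⟩ := h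
    refine ⟨A, hA, hd, le_trans (ENNReal.tsum_le_tsum fun k => ?_) hs.le⟩
    rcases (A k).eq_empty_or_nonempty with h | h
    · rw [h, Metric.ediam_empty, ENNReal.zero_rpow_of_pos (by positivity)]
      exact zero_le
    · exact le_iSup_of_le h le_rfl
  choose A hA hdiam hsum using hcover
  let F : ℕ → (ι → ℝ) → ℝ≥0∞ := fun n y => ∑' k,
    (toMeasurable volume (f '' A n k)).indicator (fun _ => Metric.ediam (A n k) ^ t) y
  have hF_meas : ∀ n, Measurable (F n) := fun n => Measurable.tsum fun k =>
    measurable_const.indicator (measurableSet_toMeasurable _ _)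
  have hF_int : ∀ n, ∫⁻ y, F n y ≤ (n : ℝ≥0∞)⁻¹ := by
    intro n
    rw [lintegral_tsum fun k =>
      (measurable_const.indicator (measurableSet_toMeasurable _ _)).aemeasurable]
    refine le_trans (ENNReal.tsum_le_tsum fun k => ?_) (hsum n)
    rw [lintegral_indicator_const (measurableSet_toMeasurable _ _), measure_toMeasurable,
      ENNReal.rpow_add_of_nonneg _ _ ht.le (Nat.cast_nonneg _), ENNReal.rpow_natCast]
    gcongr
    refine (Real.volume_pi_le_diam_pow _).trans ?_
    gcongr
    simpa using hf.ediam_image_le (A n k)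
  have hlim : ∀ᵐ y, liminf (fun n => F n y) atTop = 0 := by
    have h : ∫⁻ y, liminf (fun n => F n y) atTop = 0 := by
      refine le_antisymm ((lintegral_liminf_le hF_meas).trans ?_) zero_le
      exact (liminf_le_liminf (Eventually.of_forall hF_int)).trans
        ENNReal.tendsto_inv_nat_nhds_zero.liminf_eq.le
    exact (lintegral_eq_zero_iff (Measurable.liminf hF_meas)).1 h
  filter_upwards [hlim] with y hy
  classical
  let B : ℕ → ℕ → Set X := fun n k =>
    if y ∈ toMeasurable volume (f '' A n k) then A n k else ∅
  refine le_antisymm ((Measure.hausdorffMeasure_le_liminf_tsum t _ _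
    ENNReal.tendsto_inv_nat_nhds_zero B (Eventually.of_forall fun n k => ?_)
    (Eventually.of_forall fun n => ?_)).trans ?_) zero_le
  · by_cases h : y ∈ toMeasurable volume (f '' A n k) <;> simp [B, h, hdiam]
  · rintro x ⟨hx, rfl⟩
    obtain ⟨k, hk⟩ := mem_iUnion.1 (hA n hx)
    have h : f x ∈ toMeasurable volume (f '' A n k) :=
      subset_toMeasurable _ _ (mem_image_of_mem f hk)
    exact mem_iUnion.2 ⟨k, by simpa [B, h] using hk⟩
  · rw [← hy]
    refine (congrArg (fun u : ℕ → ℝ≥0∞ => liminf u atTop)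
      (funext fun n => tsum_congr fun k => ?_)).le
    by_cases h : y ∈ toMeasurable volume (f '' A n k) <;> simp [B, h, ht]

/-- A set has Hausdorff dimension at least `s + card ι` if its fibres under a nonexpanding map to
`ι → ℝ` have dimension at least `s > 0` over a set of base points of positive measure. -/
theorem add_card_le_dimH_of_le_dimH_inter_preimage {X ι : Type*} [Fintype ι] [EMetricSpace X]
    {f : X → ι → ℝ} (hf : LipschitzWith 1 f) {E : Set X} {s : ℝ≥0∞} (hs : 0 < s)
    {B : Set (ι → ℝ)} (hB : volume B ≠ 0) (hE : ∀ y ∈ B, s ≤ dimH (E ∩ f ⁻¹' {y})) :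
    s + Fintype.card ι ≤ dimH E := by
  borelize X
  by_contra! hlt
  have hsub : dimH E - Fintype.card ι < s := by
    rcases le_total (Fintype.card ι : ℝ≥0∞) (dimH E) with h | h
    · exact (ENNReal.sub_lt_iff_lt_right (by simp) h).2 hlt
    · rwa [tsub_eq_zero_of_le h]
  obtain ⟨t, ht, hts⟩ := ENNReal.lt_iff_exists_nnreal_btwn.1 hsub
  have ht0 : (0 : ℝ) < t := by exact_mod_cast zero_le.trans_lt ht
  have hnull : μH[(t : ℝ) + Fintype.card ι] E = 0 := by
    have h : dimH E < ((t + Fintype.card ι : ℝ≥0) : ℝ≥0∞) := by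
      push_cast
      exact ENNReal.lt_add_of_sub_lt_right (Or.inr (by simp)) ht
    exact_mod_cast hausdorffMeasure_of_dimH_lt h
  refine hB (measure_mono_null ?_
    (ae_iff.1 (ae_hausdorffMeasure_inter_preimage_eq_zero hf ht0 hnull)))
  intro y hy h
  have hne : μH[t] (E ∩ f ⁻¹' {y}) ≠ ∞ := by
    rw [show μH[t] (E ∩ f ⁻¹' {y}) = 0 from h]
    exact ENNReal.zero_ne_top
  exact (hts.trans_le (hE y hy)).not_ge (dimH_le_of_hausdorffMeasure_ne_top hne)

/-- The graph of a function on the unit cube has dimension at least that of the cube. -/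
theorem card_le_dimH_graph_unitCube {ι : Type*} [Fintype ι] (G : (ι → ℝ) → ℝ) :
    (Fintype.card ι : ℝ≥0∞) ≤
      dimH {p : (ι → ℝ) × ℝ | (∀ i, p.1 i ∈ Icc (0 : ℝ) 1) ∧ G p.1 = p.2} := by
  have hmem : Icc (0 : ι → ℝ) 1 ∈ 𝓝 (fun _ => 1 / 2 : ι → ℝ) := by
    rw [← pi_univ_Icc]
    exact set_pi_mem_nhds finite_univ fun i _ => Icc_mem_nhds (by norm_num) (by norm_num)
  rw [← Module.finrank_fintype_fun_eq_card ℝ, ← Real.dimH_of_mem_nhds hmem]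
  refine le_trans (dimH_mono ?_) (LipschitzWith.prod_fst.dimH_image_le _)
  intro x hx
  exact ⟨(x, G x), ⟨fun i => ⟨hx.1 i, hx.2 i⟩, rfl⟩, rfl⟩

/-- Adding functions of further variables raises the dimension of a graph by at least the number
of these variables. -/
theorem dimH_graph_add_le_dimH_graph_sum {d : ℕ} (g : Fin d → ℝ → ℝ) (i : Fin d) {s : ℝ≥0∞}
    (hs : 0 < s) (hg : s ≤ dimH {p : ℝ × ℝ | p.1 ∈ Icc (0 : ℝ) 1 ∧ g i p.1 = p.2}) :
    s + (d - 1 : ℕ) ≤ dimH {p : (Fin d → ℝ) × ℝ |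
      (∀ i, p.1 i ∈ Icc (0 : ℝ) 1) ∧ ∑ i, g i (p.1 i) = p.2} := by
  let f : (Fin d → ℝ) × ℝ → {j // j ≠ i} → ℝ := fun p j => p.1 j
  have hf : LipschitzWith 1 f := LipschitzWith.of_dist_le_mul fun p q => by
    rw [NNReal.coe_one, one_mul, dist_pi_le_iff dist_nonneg]
    exact fun j => (dist_le_pi_dist p.1 q.1 j).trans (le_max_left _ _)
  have hB : volume (Icc (0 : {j // j ≠ i} → ℝ) 1) ≠ 0 := by
    simp [Real.volume_Icc_pi]
  have hcard : Fintype.card {j // j ≠ i} = d - 1 := by simp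
  rw [← hcard]
  refine add_card_le_dimH_of_le_dimH_inter_preimage hf hs hB fun y hy => hg.trans ?_
  let c : ℝ := ∑ j : {j // j ≠ i}, g j (y j)
  let π : (Fin d → ℝ) × ℝ → ℝ × ℝ := fun p => (p.1 i, p.2 - c)
  have hπ : LipschitzWith 1 π := LipschitzWith.of_dist_le_mul fun p q => by
    rw [NNReal.coe_one, one_mul]
    refine max_le ((dist_le_pi_dist p.1 q.1 i).trans (le_max_left _ _)) ?_
    simp only [π, dist_sub_right]
    exact le_max_right _ _
  refine (dimH_mono ?_).trans (hπ.dimH_image_le _)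
  rintro ⟨a, b⟩ ⟨ha, hab⟩
  let x : Fin d → ℝ := fun j => if h : j = i then a else y ⟨j, h⟩
  have hxi : x i = a := by simp [x]
  have hxj : ∀ j : {j // j ≠ i}, x j = y j := fun j => by simp [x, j.2]
  refine ⟨(x, b + c), ⟨⟨fun j => ?_, ?_⟩, funext hxj⟩, by simp [π, hxi]⟩
  · by_cases h : j = i
    · subst h
      rwa [show (x, b + c).1 j = a from hxi]
    · rw [show (x, b + c).1 j = y ⟨j, h⟩ from hxj ⟨j, h⟩]
      exact ⟨hy.1 _, hy.2 _⟩
  · change ∑ j, g j (x j) = b + c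
    rw [Fintype.sum_eq_add_sum_subtype_ne _ i, hxi, show b = g i a from hab.symm]
    simp only [hxj, c]

/-- **Lemma (graphs of sums of functions).** Let `d ≥ 2` and `g_i : [0,1] → ℝ` be functions
with `dim_H graph(g_i) ≥ 2 − δ_i` for each `i`.  Then the graph of
`(x_1,…,x_d) ↦ Σ_i g_i(x_i)` has Hausdorff dimension at least `d + 1 − min_i δ_i`. -/
theorem stmt19 (d : ℕ) (hd : 2 ≤ d) (g : Fin d → ℝ → ℝ) (δ : Fin d → ℝ)
    (hg : ∀ i, ENNReal.ofReal (2 - δ i)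
        ≤ dimH {p : ℝ × ℝ | p.1 ∈ Icc (0 : ℝ) 1 ∧ g i p.1 = p.2}) :
    ENNReal.ofReal (d + 1 - ⨅ i, δ i)
      ≤ dimH {p : (Fin d → ℝ) × ℝ |
          (∀ i, p.1 i ∈ Icc (0 : ℝ) 1) ∧ ∑ i, g i (p.1 i) = p.2} := by
  have : Nonempty (Fin d) := ⟨⟨0, by omega⟩⟩
  obtain ⟨i, hi⟩ := exists_eq_ciInf_of_finite (f := δ)
  rw [← hi]
  rcases le_or_gt 1 (δ i) with h | h
  · refine le_trans ?_ (card_le_dimH_graph_unitCube fun x => ∑ i, g i (x i))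
    rw [Fintype.card_fin, ← ENNReal.ofReal_natCast]
    exact ENNReal.ofReal_le_ofReal (by linarith)
  · have hpos : 0 < 2 - δ i := by linarith
    refine le_trans (le_of_eq ?_) (dimH_graph_add_le_dimH_graph_sum g i
      (ENNReal.ofReal_pos.2 hpos) (hg i))
    rw [← ENNReal.ofReal_natCast, ← ENNReal.ofReal_add hpos.le (Nat.cast_nonneg _),
      Nat.cast_sub (by omega)]
    congr 1
    push_cast
    ring
end
end
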